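/- arXiv:0912.2362 — 6 statements merged into one kernel-verified Lean document; each statement's English description precedes it below -/
import Mathlib

section
/- Let N ≥ 1, let 0 < p < 1 be real, q = 1 − p, and let y_1 < y_2 < … < y_N be integers. Let r > 0 satisfy r + q r² < p. Then for every X = (x_1,…,x_N) ∈ ℤ^N the function t ↦ u(X;t) (defined by the N-fold contour-integral Bethe-ansatz formula) is differentiable on ℝ and satisfies the free master equation d/dt u(X;t) = Σ_{i=1}^N ( p·u(X_i^−;t) + q·u(X_i^+;t) − u(X;t) ), where X_i^± denotes X with its i-th coordinate replaced by x_i ± 1. -/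
open Finset

noncomputable section

/-- The Bethe-ansatz two-particle factor `S_{αβ}` evaluated at `a = ξ_α`, `b = ξ_β`. -/
def Sfac (p q a b : ℂ) : ℂ := -(p + q * a * b - a) / (p + q * a * b - b)

/-- `A_σ`, the product of `S_{αβ}` over all inversions `(α,β) = (σ(i),σ(j))`, `i < j`,
`σ(i) > σ(j)`, of the permutation `σ`. -/
def Aperm {N : ℕ} (p q : ℂ) (ξ : Fin N → ℂ) (σ : Equiv.Perm (Fin N)) : ℂ :=
  ∏ pr ∈ Finset.univ.filter (fun pr : Fin N × Fin N => pr.1 < pr.2 ∧ σ pr.2 < σ pr.1),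
    Sfac p q (ξ (σ pr.1)) (ξ (σ pr.2))

/-- `ε(ξ) = p ξ⁻¹ + q ξ - 1`. -/
def epsATW (p q ξ : ℂ) : ℂ := p * ξ⁻¹ + q * ξ - 1

/-- Iterated contour integral over `n` copies of the circle `|ξ| = r`
(counterclockwise, centered at 0), without the `(2πi)⁻ⁿ` normalization. -/
def multiCircleIntegral : (n : ℕ) → ((Fin n → ℂ) → ℂ) → ℝ → ℂ
  | 0, f, _ => f ![]
  | n + 1, f, r => ∮ z in C(0, r), multiCircleIntegral n (fun ξ => f (Fin.cons z ξ)) r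

/-- The Bethe-ansatz contour-integral formula
`u(X;t) = Σ_σ (2πi)^{-N} ∮⋯∮ A_σ Π_i ξ_{σ(i)}^{x_i - y_{σ(i)} - 1} e^{Σ_i ε(ξ_i) t} dξ`. -/
def betheU {N : ℕ} (p q : ℂ) (y : Fin N → ℤ) (r : ℝ) (X : Fin N → ℤ) (t : ℝ) : ℂ :=
  ∑ σ : Equiv.Perm (Fin N),
    (2 * (Real.pi : ℂ) * Complex.I)⁻¹ ^ N *
      multiCircleIntegral N
        (fun ξ => Aperm p q ξ σ * (∏ i, ξ (σ i) ^ (X i - y (σ i) - 1)) *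
          Complex.exp ((∑ i, epsATW p q (ξ i)) * (t : ℂ))) r

/-- The point of the `n`-fold torus of radius `r` with angles `θ`. -/
def torusPoint {n : ℕ} (r : ℝ) (θ : Fin n → ℝ) : Fin n → ℂ := fun i => circleMap 0 r (θ i)

theorem cons_torusPoint {n : ℕ} (r φ : ℝ) (θ : Fin n → ℝ) :
    (Fin.cons (circleMap 0 r φ) (torusPoint r θ) : Fin (n + 1) → ℂ) =
      torusPoint r (Fin.cons φ θ) := by
  funext i
  refine Fin.cases ?_ (fun j => ?_) i <;> simp [torusPoint]

theorem norm_torusPoint {n : ℕ} {r : ℝ} (hr : 0 ≤ r) (θ : Fin n → ℝ) (i : Fin n) :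
    ‖torusPoint r θ i‖ = r := by
  simp [torusPoint, abs_of_nonneg hr]

theorem continuous_torusPoint {n : ℕ} (r : ℝ) :
    Continuous (torusPoint r : (Fin n → ℝ) → Fin n → ℂ) :=
  continuous_pi fun i => (continuous_circleMap 0 r).comp (continuous_apply i)

/-- Joint continuity on the torus is inherited by the slices with a fixed first coordinate. -/
theorem continuous_slice_torusPoint {P : Type*} [TopologicalSpace P] {n : ℕ} {r : ℝ}
    {F : P → (Fin (n + 1) → ℂ) → ℂ}
    (hF : Continuous fun x : P × (Fin (n + 1) → ℝ) => F x.1 (torusPoint r x.2)) :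
    Continuous fun x : (P × ℝ) × (Fin n → ℝ) =>
      F x.1.1 (Fin.cons (circleMap 0 r x.1.2) (torusPoint r x.2)) := by
  simp only [cons_torusPoint]
  refine hF.comp (continuous_fst.fst.prodMk (continuous_pi fun i => ?_))
  refine Fin.cases ?_ (fun j => ?_) i
  · exact continuous_fst.snd
  · exact (continuous_apply j).comp continuous_snd

theorem multiCircleIntegral_congr {n : ℕ} {r : ℝ} {f g : (Fin n → ℂ) → ℂ}
    (h : ∀ θ, f (torusPoint r θ) = g (torusPoint r θ)) :
    multiCircleIntegral n f r = multiCircleIntegral n g r := by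
  induction n with
  | zero => simpa [multiCircleIntegral, Subsingleton.elim (torusPoint r ![]) ![]] using h ![]
  | succ n ih =>
    simp only [multiCircleIntegral, circleIntegral]
    congr 1
    funext φ
    congr 1
    exact ih fun θ => by simpa only [cons_torusPoint] using h (Fin.cons φ θ)

theorem continuous_multiCircleIntegral {P : Type*} [TopologicalSpace P] {n : ℕ} {r : ℝ}
    {F : P → (Fin n → ℂ) → ℂ}
    (hF : Continuous fun x : P × (Fin n → ℝ) => F x.1 (torusPoint r x.2)) :
    Continuous fun s => multiCircleIntegral n (F s) r := by
  induction n generalizing P with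
  | zero =>
    have := hF.comp (continuous_id.prodMk (continuous_const (y := (![] : Fin 0 → ℝ))))
    simpa [multiCircleIntegral, Function.comp_def,
      Subsingleton.elim (torusPoint r ![]) ![]] using this
  | succ n ih =>
    have h := ih (F := fun (x : P × ℝ) ξ => F x.1 (Fin.cons (circleMap 0 r x.2) ξ))
      (continuous_slice_torusPoint hF)
    simp only [multiCircleIntegral, circleIntegral, deriv_circleMap]
    refine intervalIntegral.continuous_parametric_intervalIntegral_of_continuous' ?_ _ _
    exact (((continuous_circleMap 0 r).comp continuous_snd).mul continuous_const).smul h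

theorem continuous_multiCircleIntegral_cons {n : ℕ} {r : ℝ} {f : (Fin (n + 1) → ℂ) → ℂ}
    (hf : Continuous fun θ => f (torusPoint r θ)) :
    Continuous fun φ : ℝ =>
      multiCircleIntegral n (fun ξ => f (Fin.cons (circleMap 0 r φ) ξ)) r := by
  have h : Continuous fun x : Unit × (Fin (n + 1) → ℝ) => f (torusPoint r x.2) :=
    hf.comp continuous_snd
  exact (continuous_multiCircleIntegral
    (F := fun (x : Unit × ℝ) ξ => f (Fin.cons (circleMap 0 r x.2) ξ))
    (continuous_slice_torusPoint (F := fun _ => f) h)).comp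
      (continuous_const.prodMk continuous_id)
      (f := fun φ : ℝ => ((), φ))

theorem continuous_fixed_slice {n : ℕ} {r : ℝ} {f : (Fin (n + 1) → ℂ) → ℂ}
    (hf : Continuous fun θ => f (torusPoint r θ)) (φ : ℝ) :
    Continuous fun θ => f (Fin.cons (circleMap 0 r φ) (torusPoint r θ)) := by
  have h : Continuous fun x : Unit × (Fin (n + 1) → ℝ) => f (torusPoint r x.2) :=
    hf.comp continuous_snd
  exact (continuous_slice_torusPoint (F := fun _ => f) h).comp
    (continuous_const.prodMk continuous_id) (f := fun θ => (((), φ), θ))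

theorem multiCircleIntegral_const_mul {n : ℕ} {r : ℝ} (c : ℂ) (f : (Fin n → ℂ) → ℂ) :
    multiCircleIntegral n (fun ξ => c * f ξ) r = c * multiCircleIntegral n f r := by
  induction n with
  | zero => rfl
  | succ n ih => simp only [multiCircleIntegral, ih, circleIntegral.integral_const_mul]

theorem multiCircleIntegral_add {n : ℕ} {r : ℝ} {f g : (Fin n → ℂ) → ℂ}
    (hf : Continuous fun θ => f (torusPoint r θ)) (hg : Continuous fun θ => g (torusPoint r θ)) :
    multiCircleIntegral n (fun ξ => f ξ + g ξ) r =
      multiCircleIntegral n f r + multiCircleIntegral n g r := by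
  induction n with
  | zero => rfl
  | succ n ih =>
    simp only [multiCircleIntegral, circleIntegral]
    rw [← intervalIntegral.integral_add]
    · congr 1
      funext φ
      rw [ih (continuous_fixed_slice hf φ) (continuous_fixed_slice hg φ), smul_add]
    all_goals
      refine Continuous.intervalIntegrable ?_ _ _
      simp only [deriv_circleMap]
      refine ((continuous_circleMap 0 r).mul continuous_const).smul
        (continuous_multiCircleIntegral_cons ?_)
      assumption

theorem multiCircleIntegral_sum {ι : Type*} (s : Finset ι) {n : ℕ} {r : ℝ}
    {f : ι → (Fin n → ℂ) → ℂ} (hf : ∀ i, Continuous fun θ => f i (torusPoint r θ)) :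
    multiCircleIntegral n (fun ξ => ∑ i ∈ s, f i ξ) r =
      ∑ i ∈ s, multiCircleIntegral n (f i) r := by
  classical
  induction s using Finset.induction_on with
  | empty => simpa using multiCircleIntegral_const_mul (n := n) (r := r) 0 fun _ => 0
  | insert a s ha ih =>
    simp only [Finset.sum_insert ha]
    rw [multiCircleIntegral_add (hf a) (continuous_finsetSum s fun i _ => hf i), ih]

/-- Differentiation under the iterated contour integral. -/
theorem hasDerivAt_multiCircleIntegral {n : ℕ} {r : ℝ} {F F' : ℝ → (Fin n → ℂ) → ℂ}
    (hF : Continuous fun x : ℝ × (Fin n → ℝ) => F x.1 (torusPoint r x.2))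
    (hF' : Continuous fun x : ℝ × (Fin n → ℝ) => F' x.1 (torusPoint r x.2))
    (h : ∀ s θ, HasDerivAt (fun s => F s (torusPoint r θ)) (F' s (torusPoint r θ)) s) (t : ℝ) :
    HasDerivAt (fun s => multiCircleIntegral n (F s) r) (multiCircleIntegral n (F' t) r) t := by
  induction n generalizing t with
  | zero => simpa [multiCircleIntegral, Subsingleton.elim (torusPoint r ![]) ![]] using h t ![]
  | succ n ih =>
    have cF := continuous_multiCircleIntegral
      (F := fun (x : ℝ × ℝ) ξ => F x.1 (Fin.cons (circleMap 0 r x.2) ξ))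
      (continuous_slice_torusPoint hF)
    have cF' := continuous_multiCircleIntegral
      (F := fun (x : ℝ × ℝ) ξ => F' x.1 (Fin.cons (circleMap 0 r x.2) ξ))
      (continuous_slice_torusPoint hF')
    simp only [multiCircleIntegral, circleIntegral, deriv_circleMap]
    have cc : Continuous fun x : ℝ × ℝ => circleMap 0 r x.2 * Complex.I :=
      ((continuous_circleMap 0 r).comp continuous_snd).mul continuous_const
    have cG := cc.smul cF
    have cG' := cc.smul cF'
    obtain ⟨C, hC⟩ := ((isCompact_closedBall t 1).prod
      (isCompact_uIcc (a := (0 : ℝ)) (b := 2 * Real.pi))).exists_bound_of_continuousOn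
        cG'.continuousOn
    refine (intervalIntegral.hasDerivAt_integral_of_dominated_loc_of_deriv_le
      (μ := MeasureTheory.volume)
      (F := fun s φ => (circleMap 0 r φ * Complex.I) •
        multiCircleIntegral n (fun ξ => F s (Fin.cons (circleMap 0 r φ) ξ)) r)
      (F' := fun s φ => (circleMap 0 r φ * Complex.I) •
        multiCircleIntegral n (fun ξ => F' s (Fin.cons (circleMap 0 r φ) ξ)) r)
      (bound := fun _ => C) (Metric.ball_mem_nhds t one_pos) (Filter.Eventually.of_forall
        fun s => ?_) ?_ ?_ ?_ ?_ ?_).2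
    · exact (cG.comp (Continuous.prodMk_right s)).aestronglyMeasurable
    · exact (cG.comp (Continuous.prodMk_right t)).intervalIntegrable _ _
    · exact (cG'.comp (Continuous.prodMk_right t)).aestronglyMeasurable
    · exact Filter.Eventually.of_forall fun φ hφ s hs =>
        hC (s, φ) ⟨Metric.ball_subset_closedBall hs, Set.uIoc_subset_uIcc hφ⟩
    · exact intervalIntegrable_const
    · refine Filter.Eventually.of_forall fun φ _ s _ => HasDerivAt.fun_const_smul _ ?_
      have e : Continuous fun x : ℝ × (Fin n → ℝ) => ((x.1, φ), x.2) := by fun_prop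
      refine ih (F := fun s ξ => F s (Fin.cons (circleMap 0 r φ) ξ))
        (F' := fun s ξ => F' s (Fin.cons (circleMap 0 r φ) ξ))
        ((continuous_slice_torusPoint hF).comp e) ((continuous_slice_torusPoint hF').comp e)
        (fun s θ => ?_) s
      simpa only [cons_torusPoint] using h s (Fin.cons φ θ)

theorem Sfac_denom_ne_zero {p q r : ℝ} (hq : 0 ≤ q) (hrpq : r + q * r ^ 2 < p)
    {a b : ℂ} (ha : ‖a‖ = r) (hb : ‖b‖ = r) : (p : ℂ) + q * a * b - b ≠ 0 := by
  intro h
  have e : (p : ℂ) = b - q * a * b := by linear_combination h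
  have h1 : ‖(p : ℂ)‖ ≤ r + q * r ^ 2 := by
    rw [e]
    refine (norm_sub_le _ _).trans_eq ?_
    rw [norm_mul, norm_mul, ha, hb, Complex.norm_real, Real.norm_of_nonneg hq]
    ring
  rw [Complex.norm_real] at h1
  linarith [Real.le_norm_self p]

theorem continuous_Aperm_torusPoint {N : ℕ} {p q r : ℝ} (hq : 0 ≤ q) (hr : 0 ≤ r)
    (hrpq : r + q * r ^ 2 < p) (σ : Equiv.Perm (Fin N)) :
    Continuous fun θ => Aperm (p : ℂ) q (torusPoint r θ) σ := by
  have c : ∀ i, Continuous fun θ : Fin N → ℝ => torusPoint r θ i := fun i =>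
    (continuous_apply i).comp (continuous_torusPoint r)
  unfold Aperm Sfac
  refine continuous_finsetProd _ fun pr _ => Continuous.div ?_ ?_ fun θ =>
    Sfac_denom_ne_zero hq hrpq (norm_torusPoint hr θ _) (norm_torusPoint hr θ _)
  · have := c (σ pr.1); have := c (σ pr.2); fun_prop
  · have := c (σ pr.1); have := c (σ pr.2); fun_prop

theorem prod_zpow_update {ι : Type*} [Fintype ι] [DecidableEq ι] {z : ι → ℂ}
    (hz : ∀ i, z i ≠ 0) (X y : ι → ℤ) (i : ι) (k : ℤ) :
    ∏ j, z j ^ (Function.update X i (X i + k) j - y j - 1) =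
      z i ^ k * ∏ j, z j ^ (X j - y j - 1) := by
  rw [← Finset.mul_prod_erase _ _ (Finset.mem_univ i),
    ← Finset.mul_prod_erase _ (fun j => z j ^ (X j - y j - 1)) (Finset.mem_univ i), ← mul_assoc,
    ← zpow_add₀ (hz i), Function.update_self]
  congr 1
  · congr 1
    ring
  · refine Finset.prod_congr rfl fun j hj => ?_
    rw [Function.update_of_ne (Finset.ne_of_mem_erase hj)]

/-- The integrand of the Bethe-ansatz formula belonging to the permutation `σ`. -/
def betheIntegrand {N : ℕ} (p q : ℂ) (y : Fin N → ℤ) (σ : Equiv.Perm (Fin N))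
    (X : Fin N → ℤ) (t : ℝ) (ξ : Fin N → ℂ) : ℂ :=
  Aperm p q ξ σ * (∏ i, ξ (σ i) ^ (X i - y (σ i) - 1)) *
    Complex.exp ((∑ i, epsATW p q (ξ i)) * (t : ℂ))

theorem continuous_sum_epsATW_torusPoint {N : ℕ} (p q : ℂ) {r : ℝ} (hr : 0 < r) :
    Continuous fun θ : Fin N → ℝ => ∑ i, epsATW p q (torusPoint r θ i) := by
  refine continuous_finsetSum _ fun i _ => ?_
  have c : Continuous fun θ : Fin N → ℝ => torusPoint r θ i :=
    (continuous_apply i).comp (continuous_torusPoint r)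
  have c' := c.inv₀ fun θ => norm_pos_iff.mp ((norm_torusPoint hr.le θ i).symm ▸ hr)
  exact ((c'.const_mul p).add (c.const_mul q)).sub continuous_const

theorem continuous_betheIntegrand {N : ℕ} {p q r : ℝ} (hq : 0 ≤ q) (hr : 0 < r)
    (hrpq : r + q * r ^ 2 < p) (y : Fin N → ℤ) (σ : Equiv.Perm (Fin N)) (X : Fin N → ℤ) :
    Continuous fun x : ℝ × (Fin N → ℝ) =>
      betheIntegrand (p : ℂ) q y σ X x.1 (torusPoint r x.2) := by
  unfold betheIntegrand
  refine (((continuous_Aperm_torusPoint hq hr.le hrpq σ).comp continuous_snd).mul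
    (continuous_finsetProd _ fun i _ => ?_)).mul (Complex.continuous_exp.comp
      (((continuous_sum_epsATW_torusPoint (p : ℂ) q hr).comp continuous_snd).mul
        (Complex.continuous_ofReal.comp continuous_fst)))
  refine Continuous.zpow₀ (((continuous_apply _).comp (continuous_torusPoint r)).comp
    continuous_snd) _ fun x => Or.inl (norm_pos_iff.mp ?_)
  exact (norm_torusPoint hr.le x.2 (σ i)).symm ▸ hr

/-- Each Bethe-ansatz integrand satisfies the free master equation. -/
theorem sum_epsATW_mul_betheIntegrand {N : ℕ} (p q : ℂ) (y : Fin N → ℤ)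
    (σ : Equiv.Perm (Fin N)) (X : Fin N → ℤ) (t : ℝ) {ξ : Fin N → ℂ} (hξ : ∀ i, ξ i ≠ 0) :
    (∑ i, epsATW p q (ξ i)) * betheIntegrand p q y σ X t ξ =
      ∑ i, (p * betheIntegrand p q y σ (Function.update X i (X i - 1)) t ξ +
        q * betheIntegrand p q y σ (Function.update X i (X i + 1)) t ξ +
        (-1) * betheIntegrand p q y σ X t ξ) := by
  rw [← Equiv.sum_comp σ fun i => epsATW p q (ξ i), Finset.sum_mul]
  refine Finset.sum_congr rfl fun i _ => ?_
  have h := prod_zpow_update (fun j => hξ (σ j)) X (fun j => y (σ j)) i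
  simp only [betheIntegrand, sub_eq_add_neg (X i) 1, h, epsATW, zpow_neg_one, zpow_one]
  ring

theorem hasDerivAt_multiCircleIntegral_betheIntegrand {N : ℕ} {p q r : ℝ} (hq : 0 ≤ q)
    (hr : 0 < r) (hrpq : r + q * r ^ 2 < p) (y : Fin N → ℤ) (σ : Equiv.Perm (Fin N))
    (X : Fin N → ℤ) (t : ℝ) :
    HasDerivAt (fun s => multiCircleIntegral N (betheIntegrand (p : ℂ) q y σ X s) r)
      (∑ i, (p * multiCircleIntegral N
          (betheIntegrand (p : ℂ) q y σ (Function.update X i (X i - 1)) t) r +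
        q * multiCircleIntegral N
          (betheIntegrand (p : ℂ) q y σ (Function.update X i (X i + 1)) t) r +
        (-1) * multiCircleIntegral N (betheIntegrand (p : ℂ) q y σ X t) r)) t := by
  have c := continuous_betheIntegrand hq hr hrpq y σ
  have ct : ∀ X, Continuous fun θ => betheIntegrand (p : ℂ) q y σ X t (torusPoint r θ) :=
    fun X => (c X).comp (continuous_const.prodMk continuous_id) (f := fun θ => (t, θ))
  have cm : ∀ (a : ℂ) X, Continuous fun θ =>
      a * betheIntegrand (p : ℂ) q y σ X t (torusPoint r θ) := fun a X => (ct X).const_mul a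
  have hd := hasDerivAt_multiCircleIntegral (c X)
    (F' := fun s ξ => (∑ i, epsATW (p : ℂ) q (ξ i)) * betheIntegrand (p : ℂ) q y σ X s ξ)
    (((continuous_sum_epsATW_torusPoint (p : ℂ) q hr).comp continuous_snd).mul (c X))
    (fun s θ => by
      have := (((hasDerivAt_id s).ofReal_comp.const_mul
        (∑ i, epsATW (p : ℂ) q (torusPoint r θ i))).cexp.const_mul
        (Aperm (p : ℂ) q (torusPoint r θ) σ * ∏ i, torusPoint r θ (σ i) ^ (X i - y (σ i) - 1)))
      refine this.congr_deriv ?_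
      simp only [betheIntegrand, id, Complex.ofReal_one]
      ring) t
  refine hd.congr_deriv ?_
  rw [multiCircleIntegral_congr (g := fun ξ => ∑ i,
    (p * betheIntegrand (p : ℂ) q y σ (Function.update X i (X i - 1)) t ξ +
      q * betheIntegrand (p : ℂ) q y σ (Function.update X i (X i + 1)) t ξ +
      (-1) * betheIntegrand (p : ℂ) q y σ X t ξ))
    (fun θ => sum_epsATW_mul_betheIntegrand (p : ℂ) q y σ X t
    (ξ := torusPoint r θ) fun i => norm_pos_iff.mp ((norm_torusPoint hr.le θ i).symm ▸ hr)),
    multiCircleIntegral_sum _ fun i => ((cm _ _).add (cm _ _)).add (cm _ _)]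
  refine Finset.sum_congr rfl fun i _ => ?_
  rw [multiCircleIntegral_add ((cm _ _).add (cm _ _)) (cm _ _),
    multiCircleIntegral_add (cm _ _) (cm _ _)]
  simp only [multiCircleIntegral_const_mul]

/-- The Bethe-ansatz formula `u(X;t)` satisfies the free master equation
`d/dt u(X;t) = Σ_{i=1}^N (p u(X_i^-;t) + q u(X_i^+;t) - u(X;t))`. -/
theorem betheU_master_equation (N : ℕ) (hN : 1 ≤ N) (p q : ℝ)
    (hp0 : 0 < p) (hp1 : p < 1) (hq : q = 1 - p)
    (y : Fin N → ℤ) (hy : StrictMono y)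
    (r : ℝ) (hr : 0 < r) (hrpq : r + q * r ^ 2 < p)
    (X : Fin N → ℤ) (t : ℝ) :
    HasDerivAt (fun s => betheU (p : ℂ) (q : ℂ) y r X s)
      (∑ i : Fin N,
        ((p : ℂ) * betheU (p : ℂ) (q : ℂ) y r (Function.update X i (X i - 1)) t +
          (q : ℂ) * betheU (p : ℂ) (q : ℂ) y r (Function.update X i (X i + 1)) t -
          betheU (p : ℂ) (q : ℂ) y r X t)) t := by
  have hq0 : 0 ≤ q := by linarith
  have hu : ∀ (X : Fin N → ℤ) (s : ℝ), betheU (p : ℂ) q y r X s =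
      ∑ σ : Equiv.Perm (Fin N), (2 * (Real.pi : ℂ) * Complex.I)⁻¹ ^ N *
        multiCircleIntegral N (betheIntegrand (p : ℂ) q y σ X s) r := fun _ _ => rfl
  simp only [hu]
  refine (HasDerivAt.fun_sum fun σ (_ : σ ∈ Finset.univ) =>
    (hasDerivAt_multiCircleIntegral_betheIntegrand hq0 hr hrpq y σ X t).const_mul
      ((2 * (Real.pi : ℂ) * Complex.I)⁻¹ ^ N)).congr_deriv ?_
  simp only [Finset.mul_sum]
  rw [Finset.sum_comm]
  refine Finset.sum_congr rfl fun i _ => ?_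
  rw [← Finset.sum_add_distrib, ← Finset.sum_sub_distrib]
  refine Finset.sum_congr rfl fun σ _ => ?_
  ring

end
end

section
/- Let N ≥ 1, let 0 < p < 1 be real, q = 1 − p, let y_1 < y_2 < … < y_N be integers, and let r > 0 satisfy r + q r² < p. Then for every strictly increasing N-tuple of integers x_1 < x_2 < … < x_N, the Bethe-ansatz sum at time t = 0 satisfies the initial condition: Σ_{σ∈S_N} (2πi)^{−N} ∮_{|ξ_1|=r} ⋯ ∮_{|ξ_N|=r} A_σ · Π_{i=1}^N ξ_{σ(i)}^{x_i − y_{σ(i)} − 1} dξ_1 ⋯ dξ_N equals 1 if x_i = y_i for all i, and equals 0 otherwise. (In particular the contribution of the N! − 1 non-identity permutations sums to zero.) -/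
open Finset

noncomputable section

open MeasureTheory Complex in
theorem torusIntegral_comp_perm {n : ℕ} (σ : Equiv.Perm (Fin n)) (f : (Fin n → ℂ) → ℂ) (r : ℝ) :
    torusIntegral (fun ξ => f (ξ ∘ σ)) 0 (fun _ => r) = torusIntegral f 0 (fun _ => r) := by
  have hmp := volume_measurePreserving_piCongrLeft (fun _ : Fin n => ℝ) σ.symm
  have happ : ∀ θ : Fin n → ℝ,
      MeasurableEquiv.piCongrLeft (fun _ : Fin n => ℝ) σ.symm θ = θ ∘ σ := by
    intro θ
    funext i
    simpa using! Equiv.piCongrLeft_apply (fun _ : Fin n => ℝ) σ.symm θ i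
  have hpre : (MeasurableEquiv.piCongrLeft (fun _ : Fin n => ℝ) σ.symm) ⁻¹'
      (Set.Icc 0 fun _ => 2 * Real.pi) = Set.Icc 0 fun _ => 2 * Real.pi := by
    ext θ
    simp only [Set.mem_preimage, happ, Set.mem_Icc, Pi.le_def, Function.comp_apply, Pi.zero_apply]
    exact and_congr (σ.forall_congr_left (p := fun i => 0 ≤ θ (σ i))|>.trans (by simp))
      (σ.forall_congr_left (p := fun i => θ (σ i) ≤ 2 * Real.pi)|>.trans (by simp))
  symm
  rw [torusIntegral, torusIntegral,
    ← hmp.setIntegral_preimage_emb (MeasurableEquiv.measurableEmbedding _), hpre]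
  refine integral_congr_ae (ae_of_all _ fun θ => ?_)
  simp only [happ, Function.comp_apply]
  congr 1
  · exact Equiv.prod_comp σ fun i => (r * exp (θ i * I) * I : ℂ)

theorem torusIntegral_congr_norm {n : ℕ} {r : ℝ} (hr : 0 ≤ r) {f g : (Fin n → ℂ) → ℂ}
    (h : ∀ ξ : Fin n → ℂ, (∀ i, ‖ξ i‖ = r) → f ξ = g ξ) :
    torusIntegral f 0 (fun _ => r) = torusIntegral g 0 (fun _ => r) := by
  unfold torusIntegral
  refine MeasureTheory.integral_congr_ae (MeasureTheory.ae_of_all _ fun θ => ?_)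
  simp only
  rw [h]
  intro i
  simp [torusMap, abs_of_nonneg hr, Complex.norm_exp_ofReal_mul_I]

theorem TorusIntegrable.of_continuousAt {n : ℕ} {r : ℝ} (hr : 0 ≤ r) {f : (Fin n → ℂ) → ℂ}
    (h : ∀ ξ : Fin n → ℂ, (∀ i, ‖ξ i‖ = r) → ContinuousAt f ξ) :
    TorusIntegrable f 0 (fun _ => r) := by
  refine Continuous.integrableOn_Icc (continuous_iff_continuousAt.2 fun θ => ?_)
  refine ContinuousAt.comp (h _ fun i => ?_) ?_
  · simp [torusMap, abs_of_nonneg hr, Complex.norm_exp_ofReal_mul_I]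
  · refine Continuous.continuousAt ?_
    unfold torusMap
    fun_prop

open MeasureTheory Complex in
theorem torusIntegral_eq_zero_of_circleIntegral_eq_zero {n : ℕ} {f : (Fin (n + 1) → ℂ) → ℂ}
    {c : Fin (n + 1) → ℂ} {R : Fin (n + 1) → ℝ} (hf : TorusIntegrable f c R) (i : Fin (n + 1))
    (h : ∀ θ : Fin n → ℝ, (∮ z in C(c i, R i),
      f (i.insertNth z (torusMap (c ∘ i.succAbove) (R ∘ i.succAbove) θ))) = 0) :
    torusIntegral f c R = 0 := by
  set e : ℝ × (Fin n → ℝ) ≃ᵐ (Fin (n + 1) → ℝ) :=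
    (MeasurableEquiv.piFinSuccAbove (fun _ => ℝ) i).symm with he
  have hem : MeasurePreserving e :=
    (volume_preserving_piFinSuccAbove (fun _ : Fin (n + 1) => ℝ) i).symm _
  have heπ : (e ⁻¹' Set.Icc 0 fun _ => 2 * Real.pi) =
      Set.Icc 0 (2 * Real.pi) ×ˢ Set.Icc (0 : Fin n → ℝ) fun _ => 2 * Real.pi :=
    ((Fin.insertNthOrderIso (fun _ => ℝ) i).preimage_Icc _ _).trans (Set.Icc_prod_eq _ _)
  have hint := hf.function_integrable
  rw [← hem.integrableOn_comp_preimage e.measurableEmbedding, heπ, Measure.volume_eq_prod] at hint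
  rw [torusIntegral, ← hem.map_eq, setIntegral_map_equiv, heπ, Measure.volume_eq_prod,
    ← setIntegral_prod_swap, setIntegral_prod]
  swap
  · exact hint.swap
  refine setIntegral_eq_zero_of_forall_eq_zero fun Θ _ => ?_
  rw [← mul_zero (∏ k, (R (i.succAbove k) * exp (Θ k * I) * I : ℂ)), ← h Θ,
    circleIntegral_def_Icc, ← integral_const_mul]
  refine setIntegral_congr_fun measurableSet_Icc fun θ _ => ?_
  have hmap : torusMap c R (i.insertNth θ Θ) =
      i.insertNth (circleMap (c i) (R i) θ)
        (torusMap (c ∘ i.succAbove) (R ∘ i.succAbove) Θ) := by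
    simp [funext_iff, i.forall_iff_succAbove, circleMap, torusMap]
  have happ : e (θ, Θ) = i.insertNth θ Θ := rfl
  simp only [Prod.swap_prod_mk, happ, hmap, i.prod_univ_succAbove _, deriv_circleMap,
    i.insertNth_apply_same, i.insertNth_apply_succAbove, smul_eq_mul, circleMap_zero]
  ring

theorem multiCircleIntegral_eq_torusIntegral {r : ℝ} (hr : 0 ≤ r) : ∀ {n : ℕ} {f : (Fin n → ℂ) → ℂ},
    (∀ ξ : Fin n → ℂ, (∀ i, ‖ξ i‖ = r) → ContinuousAt f ξ) →
    multiCircleIntegral n f r = torusIntegral f 0 (fun _ => r)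
  | 0, f, _ => by
    rw [torusIntegral_dim0, multiCircleIntegral]
    congr 1
    exact Subsingleton.elim _ _
  | n + 1, f, hf => by
    rw [torusIntegral_succ (.of_continuousAt hr hf), multiCircleIntegral]
    refine circleIntegral.integral_congr hr fun z hz => ?_
    refine multiCircleIntegral_eq_torusIntegral hr fun ξ hξ => ?_
    have hz' : ‖z‖ = r := by simpa using hz
    refine ContinuousAt.comp (hf _ (Fin.cases (by simpa) (by simpa))) ?_
    exact (Continuous.finCons continuous_const continuous_id).continuousAt

theorem torusIntegral_zpow_mul_tail {n : ℕ} {r : ℝ} (hr : 0 < r) (k : ℤ) {g : (Fin n → ℂ) → ℂ}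
    (hg : ∀ ξ : Fin n → ℂ, (∀ i, ‖ξ i‖ = r) → ContinuousAt g ξ) :
    torusIntegral (fun ξ : Fin (n + 1) → ℂ => ξ 0 ^ k * g (Fin.tail ξ)) 0 (fun _ => r) =
      (if k = -1 then 2 * Real.pi * Complex.I else 0) * torusIntegral g 0 (fun _ => r) := by
  have hint : TorusIntegrable (fun ξ : Fin (n + 1) → ℂ => ξ 0 ^ k * g (Fin.tail ξ)) 0
      (fun _ => r) := by
    refine .of_continuousAt hr.le fun ξ hξ => ?_
    refine ContinuousAt.mul (ContinuousAt.zpow₀ (continuous_apply 0).continuousAt _ (.inl ?_)) ?_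
    · rw [← norm_ne_zero_iff, hξ]
      exact hr.ne'
    · refine ContinuousAt.comp (f := Fin.tail) (hg _ fun i => hξ _) (Continuous.continuousAt ?_)
      unfold Fin.tail
      fun_prop
  rw [torusIntegral_succ hint]
  simp only [Fin.cons_zero, Fin.tail_cons, torusIntegral_const_mul]
  have hmul := circleIntegral.integral_smul_const (fun z : ℂ => z ^ k)
    (torusIntegral g 0 fun _ => r) 0 r
  simp only [smul_eq_mul] at hmul
  refine hmul.trans ?_
  congr 1
  split_ifs with hk
  · subst hk
    simpa using circleIntegral.integral_sub_center_inv 0 hr.ne'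
  · simpa using circleIntegral.integral_sub_zpow_of_ne hk 0 0 r

theorem torusIntegral_sum {ι : Type*} {n : ℕ} {f : ι → (Fin n → ℂ) → ℂ} {c : Fin n → ℂ}
    {R : Fin n → ℝ} (s : Finset ι) (hf : ∀ i ∈ s, TorusIntegrable (f i) c R) :
    torusIntegral (fun ξ => ∑ i ∈ s, f i ξ) c R = ∑ i ∈ s, torusIntegral (f i) c R := by
  simp only [torusIntegral, Finset.smul_sum]
  exact MeasureTheory.integral_finsetSum _ fun i hi => (hf i hi).function_integrable

/-- The product of `w (σ i) (σ j)` over all inversions `(σ i, σ j)` of `σ`. -/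
def inversionProd {N : ℕ} (w : Fin N → Fin N → ℂ) (σ : Equiv.Perm (Fin N)) : ℂ :=
  ∏ i, ∏ j, if i < j ∧ σ j < σ i then w (σ i) (σ j) else 1

theorem inversionProd_inv {N : ℕ} (w : Fin N → Fin N → ℂ) (σ : Equiv.Perm (Fin N)) :
    inversionProd w σ⁻¹ = inversionProd (fun a b => w (σ⁻¹ b) (σ⁻¹ a)) σ := by
  unfold inversionProd
  rw [Finset.prod_comm, ← Equiv.prod_comp σ]
  refine Finset.prod_congr rfl fun i _ => ?_
  rw [← Equiv.prod_comp σ]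
  refine Finset.prod_congr rfl fun j _ => ?_
  simp [and_comm]

theorem inversionProd_mul_swap_of_lt {n : ℕ} (w : Fin (n + 1) → Fin (n + 1) → ℂ)
    (σ : Equiv.Perm (Fin (n + 1))) (k : Fin n) (h : σ k.castSucc < σ k.succ) :
    inversionProd w (σ * Equiv.swap k.castSucc k.succ) =
      w (σ k.succ) (σ k.castSucc) * inversionProd w σ := by
  set s := Equiv.swap k.castSucc k.succ with hs
  have hdelta : w (σ k.succ) (σ k.castSucc) =
      ∏ i, ∏ j, if i = k.succ ∧ j = k.castSucc then w (σ k.succ) (σ k.castSucc) else 1 := by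
    simp [ite_and, Finset.prod_ite_eq']
  unfold inversionProd
  rw [hdelta, ← Finset.prod_mul_distrib, ← Equiv.prod_comp s]
  refine Finset.prod_congr rfl fun i _ => ?_
  rw [← Finset.prod_mul_distrib, ← Equiv.prod_comp s]
  refine Finset.prod_congr rfl fun j _ => ?_
  have hss : ∀ a, (σ * s) (s a) = σ a := fun a => by simp [hs]
  simp only [hss]
  have hk : k.castSucc < k.succ := Fin.castSucc_lt_succ
  by_cases h1 : i = k.succ ∧ j = k.castSucc
  · obtain ⟨rfl, rfl⟩ := h1
    simp [hs, h, hk, hk.le]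
  by_cases h2 : i = k.castSucc ∧ j = k.succ
  · obtain ⟨rfl, rfl⟩ := h2
    simp [h.not_gt, hk.ne]
  have hlt : s i < s j ↔ i < j := by
    simp only [hs, Equiv.swap_apply_def]
    simp only [Fin.ext_iff, Fin.lt_def, Fin.val_castSucc, Fin.val_succ] at h1 h2 ⊢
    split_ifs <;> simp only [Fin.val_castSucc, Fin.val_succ] <;> omega
  simp only [hlt, if_neg h1, one_mul]

theorem inversionProd_antisymm {n : ℕ} {M : Fin (n + 1) → Fin (n + 1) → ℂ}
    (hM : ∀ a b, M a b ≠ 0) (σ : Equiv.Perm (Fin (n + 1))) (k : Fin n) :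
    M (σ k.succ) (σ k.castSucc) * inversionProd (fun a b => -M a b / M b a) σ +
      M (σ k.castSucc) (σ k.succ) *
        inversionProd (fun a b => -M a b / M b a) (σ * Equiv.swap k.castSucc k.succ) = 0 := by
  rcases lt_or_gt_of_ne (σ.injective.ne (Fin.castSucc_lt_succ (i := k)).ne) with h | h
  · rw [inversionProd_mul_swap_of_lt _ σ k h]
    field_simp [hM]
    ring
  · have h' := inversionProd_mul_swap_of_lt (fun a b => -M a b / M b a)
      (σ * Equiv.swap k.castSucc k.succ) k (by simpa using h)
    rw [mul_assoc, Equiv.swap_mul_self, mul_one] at h'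
    rw [h']
    simp only [Equiv.Perm.mul_apply, Equiv.swap_apply_left, Equiv.swap_apply_right]
    field_simp [hM]
    ring

theorem sum_mul_inversionProd_eq_zero {n : ℕ} {M : Fin (n + 1) → Fin (n + 1) → ℂ}
    (hM : ∀ a b, M a b ≠ 0) (k : Fin n) {c : Equiv.Perm (Fin (n + 1)) → ℂ}
    (hc : ∀ σ, c (σ * Equiv.swap k.castSucc k.succ) = c σ) :
    ∑ σ, c σ * (M (σ k.succ) (σ k.castSucc) * inversionProd (fun a b => -M a b / M b a) σ) = 0 := by
  have hpair : ∀ σ, c σ * (M (σ k.succ) (σ k.castSucc) *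
      inversionProd (fun a b => -M a b / M b a) σ) +
      c (σ * Equiv.swap k.castSucc k.succ) * (M ((σ * Equiv.swap k.castSucc k.succ) k.succ)
        ((σ * Equiv.swap k.castSucc k.succ) k.castSucc) *
      inversionProd (fun a b => -M a b / M b a) (σ * Equiv.swap k.castSucc k.succ)) = 0 := by
    intro σ
    have h := inversionProd_antisymm hM σ k
    simp only [Equiv.Perm.mul_apply, Equiv.swap_apply_left, Equiv.swap_apply_right, hc]
    linear_combination c σ * h
  have hsum := Finset.sum_congr rfl fun σ (_ : σ ∈ Finset.univ) => hpair σ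
  have hcomp := Equiv.sum_comp (Equiv.mulRight (Equiv.swap k.castSucc k.succ)) fun σ =>
      c σ * (M (σ k.succ) (σ k.castSucc) * inversionProd (fun a b => -M a b / M b a) σ)
  simp only [Equiv.coe_mulRight] at hcomp
  rw [Finset.sum_add_distrib, Finset.sum_const_zero, hcomp] at hsum
  exact self_eq_neg.1 (eq_neg_of_add_eq_zero_left hsum)

/-- The plane wave `∏ᵢ ξ_{σ(i)}^{uᵢ} ξᵢ^{vᵢ}` weighted by the product of the two-particle factors
`-m(ξ_α, ξ_β) / m(ξ_β, ξ_α)` over the inversions `(α, β)` of `σ`. -/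
def betheWave {N : ℕ} (m : ℂ → ℂ → ℂ) (u v : Fin N → ℤ) (σ : Equiv.Perm (Fin N))
    (ξ : Fin N → ℂ) : ℂ :=
  inversionProd (fun a b => -m (ξ a) (ξ b) / m (ξ b) (ξ a)) σ *
    ((∏ i, ξ (σ i) ^ u i) * ∏ i, ξ i ^ v i)

theorem continuousAt_betheWave {N : ℕ} {m : ℂ → ℂ → ℂ}
    (hmc : Continuous fun z : ℂ × ℂ => m z.1 z.2) (u v : Fin N → ℤ) (σ : Equiv.Perm (Fin N))
    {ξ : Fin N → ℂ} (hm : ∀ a b, m (ξ a) (ξ b) ≠ 0) (hξ : ∀ i, ξ i ≠ 0) :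
    ContinuousAt (betheWave m u v σ) ξ := by
  have hmab : ∀ a b : Fin N, ContinuousAt (fun ξ : Fin N → ℂ => m (ξ a) (ξ b)) ξ := fun a b =>
    (hmc.comp (g := fun z : ℂ × ℂ => m z.1 z.2) (f := fun ξ : Fin N → ℂ => (ξ a, ξ b))
      ((continuous_apply a).prodMk (continuous_apply b))).continuousAt
  unfold betheWave inversionProd
  refine .mul (tendsto_finsetProd _ fun i _ => tendsto_finsetProd _ fun j _ => ?_) (.mul
    (tendsto_finsetProd _ fun i _ => ?_) (tendsto_finsetProd _ fun i _ => ?_))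
  · split_ifs
    · exact (hmab _ _).neg.div (hmab _ _) (hm _ _)
    · exact tendsto_const_nhds
  · exact (continuous_apply _).continuousAt.zpow₀ _ (.inl (hξ _))
  · exact (continuous_apply _).continuousAt.zpow₀ _ (.inl (hξ _))

theorem prod_zpow_add_single {N : ℕ} {ξ : Fin N → ℂ} (hξ : ∀ i, ξ i ≠ 0)
    (u : Fin N → ℤ) (i : Fin N) (σ : Equiv.Perm (Fin N)) :
    ∏ l, ξ (σ l) ^ (u + Pi.single i 1 : Fin N → ℤ) l = (∏ l, ξ (σ l) ^ u l) * ξ (σ i) := by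
  simp only [Pi.add_apply, zpow_add₀ (hξ _), Finset.prod_mul_distrib]
  congr 1
  rw [Finset.prod_eq_single i] <;> simp +contextual

theorem sum_betheWave_mul_eq_zero {n : ℕ} {m : ℂ → ℂ → ℂ} {ξ : Fin (n + 1) → ℂ}
    (hm : ∀ a b, m (ξ a) (ξ b) ≠ 0) (k : Fin n) {u : Fin (n + 1) → ℤ}
    (hu : u k.castSucc = u k.succ) (v : Fin (n + 1) → ℤ) :
    ∑ σ, betheWave m u v σ ξ * m (ξ (σ k.succ)) (ξ (σ k.castSucc)) = 0 := by
  rw [← sum_mul_inversionProd_eq_zero (M := fun a b => m (ξ a) (ξ b)) hm k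
    (c := fun σ => (∏ i, ξ (σ i) ^ u i) * ∏ i, ξ i ^ v i) fun σ => ?_]
  · refine Finset.sum_congr rfl fun σ _ => ?_
    unfold betheWave
    ring
  · have hus : ∀ i, u (Equiv.swap k.castSucc k.succ i) = u i := by
      intro i
      rw [Equiv.swap_apply_def]
      split_ifs with h1 h2
      · rw [h1, hu]
      · rw [h2, hu]
      · rfl
    congr 1
    rw [← Equiv.prod_comp (Equiv.swap k.castSucc k.succ)]
    simp [hus]

theorem sum_torusIntegral_betheWave_comb {n : ℕ} {m : ℂ → ℂ → ℂ}
    (hmc : Continuous fun z : ℂ × ℂ => m z.1 z.2) {r : ℝ} (hr : 0 < r)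
    (hm : ∀ a b : ℂ, ‖a‖ ≤ r → ‖b‖ ≤ r → m a b ≠ 0) (k : Fin n) {u u' : Fin (n + 1) → ℤ}
    (hu : u k.castSucc = u k.succ) (v : Fin (n + 1) → ℤ) (p q : ℂ)
    (hu' : ∀ σ (ξ : Fin (n + 1) → ℂ), (∀ i, ξ i ≠ 0) →
      p * betheWave m u v σ ξ +
        q * betheWave m (u + Pi.single k.castSucc 1 + Pi.single k.succ 1) v σ ξ -
        betheWave m u' v σ ξ =
      betheWave m u v σ ξ * m (ξ (σ k.succ)) (ξ (σ k.castSucc))) :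
    p * ∑ σ, torusIntegral (betheWave m u v σ) 0 (fun _ => r) +
      q * ∑ σ, torusIntegral (betheWave m (u + Pi.single k.castSucc 1 + Pi.single k.succ 1) v σ) 0
        (fun _ => r) =
      ∑ σ, torusIntegral (betheWave m u' v σ) 0 (fun _ => r) := by
  have hint : ∀ (w : Fin (n + 1) → ℤ) σ, TorusIntegrable (betheWave m w v σ) 0 (fun _ => r) := by
    refine fun w σ => .of_continuousAt hr.le fun ξ hξ => continuousAt_betheWave hmc w v σ
      (fun a b => hm _ _ (hξ a).le (hξ b).le) fun i => ?_
    rw [← norm_ne_zero_iff, hξ]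
    exact hr.ne'
  rw [← torusIntegral_sum _ fun σ _ => hint _ σ, ← torusIntegral_sum _ fun σ _ => hint _ σ,
    ← torusIntegral_sum _ fun σ _ => hint _ σ, ← torusIntegral_const_mul,
    ← torusIntegral_const_mul, ← torusIntegral_add]
  · refine torusIntegral_congr_norm hr.le fun ξ hξ => ?_
    have hξ0 : ∀ i, ξ i ≠ 0 := fun i => by
      rw [← norm_ne_zero_iff, hξ]
      exact hr.ne'
    rw [← sub_eq_zero, ← sum_betheWave_mul_eq_zero (m := m) (ξ := ξ)
      (fun a b => hm _ _ (hξ a).le (hξ b).le) k hu v]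
    simp only [← hu' _ ξ hξ0, Finset.sum_sub_distrib, Finset.sum_add_distrib, Finset.mul_sum]
  all_goals
    refine .const_mul (MeasureTheory.integrable_finsetSum _ fun σ _ => hint _ σ) _

/-- The integrand of the Bethe-ansatz sum. -/
def betheTerm {N : ℕ} (p q : ℂ) (x y : Fin N → ℤ) (σ : Equiv.Perm (Fin N)) (ξ : Fin N → ℂ) : ℂ :=
  inversionProd (fun a b => Sfac p q (ξ a) (ξ b)) σ * ∏ i, ξ (σ i) ^ (x i - y (σ i) - 1)

/-- The Bethe-ansatz sum at time zero. -/
def betheSum {N : ℕ} (p q : ℂ) (r : ℝ) (x y : Fin N → ℤ) : ℂ :=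
  ∑ σ, torusIntegral (betheTerm p q x y σ) 0 (fun _ => r)

theorem betheTerm_eq_betheWave {N : ℕ} (p q : ℂ) (x y : Fin N → ℤ) (σ : Equiv.Perm (Fin N))
    {ξ : Fin N → ℂ} (hξ : ∀ i, ξ i ≠ 0) :
    betheTerm p q x y σ ξ =
      betheWave (fun a b => p + q * a * b - a) x (fun i => -y i - 1) σ ξ := by
  unfold betheTerm betheWave
  rw [← Equiv.prod_comp σ fun i => ξ i ^ (-y i - 1), ← Finset.prod_mul_distrib]
  congr 1
  · simp only [Sfac, mul_right_comm q]
  · refine Finset.prod_congr rfl fun i _ => ?_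
    rw [← zpow_add₀ (hξ _)]
    congr 1
    ring

theorem betheTerm_comp_inv {N : ℕ} (p q : ℂ) (x y : Fin N → ℤ) (σ : Equiv.Perm (Fin N))
    {ξ : Fin N → ℂ} (hξ : ∀ i, ξ i ≠ 0) :
    betheTerm p q x y σ (ξ ∘ ⇑σ⁻¹) =
      betheWave (fun a b => p + q * a * b - b) (-y) (fun i => x i - 1) σ⁻¹ ξ := by
  unfold betheTerm betheWave
  rw [inversionProd_inv, ← Equiv.prod_comp σ fun i => ξ (σ⁻¹ i) ^ (-y) i,
    ← Finset.prod_mul_distrib]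
  congr 1
  · simp only [Sfac, Function.comp_apply, mul_right_comm q]
  · refine Finset.prod_congr rfl fun i _ => ?_
    simp only [Function.comp_apply, Equiv.Perm.coe_inv, Equiv.symm_apply_apply, Pi.neg_apply]
    rw [← zpow_add₀ (hξ _)]
    congr 1
    ring

theorem betheSum_eq_sum_betheWave {N : ℕ} (p q : ℂ) {r : ℝ} (hr : 0 < r) (x y : Fin N → ℤ) :
    betheSum p q r x y = ∑ σ, torusIntegral
      (betheWave (fun a b => p + q * a * b - a) x (fun i => -y i - 1) σ) 0 (fun _ => r) := by
  refine Finset.sum_congr rfl fun σ _ => torusIntegral_congr_norm hr.le fun ξ hξ =>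
    betheTerm_eq_betheWave p q x y σ fun i => ?_
  rw [← norm_ne_zero_iff, hξ]
  exact hr.ne'

theorem betheSum_eq_sum_betheWave_neg {N : ℕ} (p q : ℂ) {r : ℝ} (hr : 0 < r) (x y : Fin N → ℤ) :
    betheSum p q r x y = ∑ σ, torusIntegral
      (betheWave (fun a b => p + q * a * b - b) (-y) (fun i => x i - 1) σ) 0 (fun _ => r) := by
  rw [← Equiv.sum_comp (Equiv.inv _)]
  refine Finset.sum_congr rfl fun σ _ => ?_
  rw [← torusIntegral_comp_perm σ⁻¹]
  refine torusIntegral_congr_norm hr.le fun ξ hξ => betheTerm_comp_inv p q x y σ fun i => ?_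
  rw [← norm_ne_zero_iff, hξ]
  exact hr.ne'

theorem betheSum_boundary_left {n : ℕ} {p q : ℂ} {r : ℝ} (hr : 0 < r)
    (hpq : ∀ a b : ℂ, ‖a‖ ≤ r → ‖b‖ ≤ r → p + q * a * b - b ≠ 0) (k : Fin n)
    {u : Fin (n + 1) → ℤ} (hu : u k.castSucc = u k.succ) (y : Fin (n + 1) → ℤ) :
    p * betheSum p q r u y +
      q * betheSum p q r (u + Pi.single k.castSucc 1 + Pi.single k.succ 1) y =
      betheSum p q r (u + Pi.single k.succ 1) y := by
  simp only [betheSum_eq_sum_betheWave p q hr]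
  refine sum_torusIntegral_betheWave_comb (by fun_prop) hr (fun a b ha hb => ?_) k hu _ p q
    fun σ ξ hξ => ?_
  · rw [mul_right_comm]
    exact hpq b a hb ha
  · simp only [betheWave, prod_zpow_add_single hξ]
    ring

theorem betheSum_boundary_right {n : ℕ} {p q : ℂ} {r : ℝ} (hr : 0 < r)
    (hpq : ∀ a b : ℂ, ‖a‖ ≤ r → ‖b‖ ≤ r → p + q * a * b - b ≠ 0) (k : Fin n)
    {u : Fin (n + 1) → ℤ} (hu : u k.castSucc = u k.succ) (x : Fin (n + 1) → ℤ) :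
    q * betheSum p q r x u +
      p * betheSum p q r x (u + Pi.single k.castSucc 1 + Pi.single k.succ 1) =
      betheSum p q r x (u + Pi.single k.succ 1) := by
  set u' : Fin (n + 1) → ℤ := -(u + Pi.single k.castSucc 1 + Pi.single k.succ 1) with hu'
  have h1 : -u = u' + Pi.single k.castSucc 1 + Pi.single k.succ 1 := by
    rw [hu']
    abel
  have h2 : -(u + Pi.single k.succ 1) = u' + Pi.single k.castSucc 1 := by
    rw [hu']
    abel
  have hk : k.castSucc ≠ k.succ := Fin.castSucc_lt_succ.ne
  simp only [betheSum_eq_sum_betheWave_neg p q hr]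
  rw [h1, h2, ← hu', add_comm]
  refine sum_torusIntegral_betheWave_comb (by fun_prop) hr hpq k
    (by simp [hu', hu, hk, hk.symm]) _ p q fun σ ξ hξ => ?_
  simp only [betheWave, prod_zpow_add_single hξ]
  ring

theorem sum_betheSum_sub_single {N : ℕ} (p q : ℂ) (r : ℝ) (x y : Fin N → ℤ) (ε : ℤ) :
    ∑ i, betheSum p q r (x - Pi.single i ε) y = ∑ i, betheSum p q r x (y + Pi.single i ε) := by
  unfold betheSum
  rw [Finset.sum_comm, Finset.sum_comm (γ := Fin N)]
  refine Finset.sum_congr rfl fun σ _ => ?_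
  refine Eq.trans ?_ (Equiv.sum_comp σ _)
  refine Finset.sum_congr rfl fun i _ => ?_
  congr 1
  funext ξ
  unfold betheTerm
  congr 1
  refine Finset.prod_congr rfl fun l _ => ?_
  congr 1
  simp only [Pi.sub_apply, Pi.add_apply, Pi.single_apply, σ.injective.eq_iff]
  ring

theorem continuousAt_betheTerm {N : ℕ} {p q : ℂ} (x y : Fin N → ℤ) (σ : Equiv.Perm (Fin N))
    {ξ : Fin N → ℂ} (hpq : ∀ a b, p + q * ξ a * ξ b - ξ b ≠ 0) (hξ : ∀ i, ξ i ≠ 0) :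
    ContinuousAt (betheTerm p q x y σ) ξ := by
  unfold betheTerm inversionProd Sfac
  refine .mul (tendsto_finsetProd _ fun i _ => tendsto_finsetProd _ fun j _ => ?_)
    (tendsto_finsetProd _ fun i _ => (continuous_apply _).continuousAt.zpow₀ _ (.inl (hξ _)))
  split_ifs
  · exact ContinuousAt.div (Continuous.continuousAt (by fun_prop))
      (Continuous.continuousAt (by fun_prop)) (hpq _ _)
  · exact tendsto_const_nhds

theorem torusIntegral_betheTerm_eq_zero {N : ℕ} {p q : ℂ} {r : ℝ} (hr : 0 < r)
    (hpq : ∀ a b : ℂ, ‖a‖ ≤ r → ‖b‖ ≤ r → p + q * a * b - b ≠ 0) (x y : Fin N → ℤ)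
    (σ : Equiv.Perm (Fin N)) {i : Fin N} (hi : y (σ i) < x i) :
    torusIntegral (betheTerm p q x y σ) 0 (fun _ => r) = 0 := by
  obtain _ | n := N
  · exact i.elim0
  have hint : TorusIntegrable (betheTerm p q x y σ) 0 (fun _ => r) :=
    .of_continuousAt hr.le fun ξ hξ => continuousAt_betheTerm x y σ
      (fun a b => hpq _ _ (hξ a).le (hξ b).le) fun i => by
        rw [← norm_ne_zero_iff, hξ]
        exact hr.ne'
  refine torusIntegral_eq_zero_of_circleIntegral_eq_zero hint (σ i) fun θ => ?_
  set η : Fin n → ℂ :=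
    torusMap ((0 : Fin (n + 1) → ℂ) ∘ (σ i).succAbove) ((fun _ => r) ∘ (σ i).succAbove) θ with hη
  have hηr : ∀ l, ‖η l‖ = r := fun l => by
    simp [hη, torusMap, abs_of_pos hr, Complex.norm_exp_ofReal_mul_I]
  clear_value η
  have hdiff : ∀ z : ℂ, ‖z‖ ≤ r → DifferentiableAt ℂ
      (fun z => betheTerm p q x y σ ((σ i).insertNth z η)) z := by
    intro z hz
    have hcoord : ∀ a, Differentiable ℂ
        (fun z : ℂ => ((σ i).insertNth z η : Fin (n + 1) → ℂ) a) := by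
      refine ((σ i).forall_iff_succAbove).2 ⟨?_, fun l => ?_⟩
      · simp
      · simp
    have hnorm : ∀ a, ‖((σ i).insertNth z η : Fin (n + 1) → ℂ) a‖ ≤ r := by
      refine ((σ i).forall_iff_succAbove).2 ⟨?_, fun l => ?_⟩
      · simpa
      · simp [hηr]
    unfold betheTerm inversionProd Sfac
    refine .mul (.fun_finsetProd fun k _ => .fun_finsetProd fun j _ => ?_)
      (.fun_finsetProd fun k _ => ?_)
    · split_ifs
      · exact .div (by fun_prop) (by fun_prop) (hpq _ _ (hnorm _) (hnorm _))
      · fun_prop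
    · refine (hcoord _ z).zpow ?_
      by_cases hk : k = i
      · subst hk
        right
        omega
      · left
        obtain ⟨l, hl⟩ := Fin.exists_succAbove_eq (σ.injective.ne hk)
        rw [← hl, Fin.insertNth_apply_succAbove, ← norm_ne_zero_iff, hηr]
        exact hr.ne'
  refine Complex.circleIntegral_eq_zero_of_differentiable_on_off_countable hr.le
    Set.countable_empty (fun z hz => (hdiff z ?_).continuousAt.continuousWithinAt)
    (fun z hz => hdiff z ?_)
  · simpa using hz
  · exact le_of_lt (by simpa using hz.1)

theorem betheTerm_decomposeFin_symm_zero {n : ℕ} (p q : ℂ) (x y : Fin (n + 1) → ℤ)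
    (e : Equiv.Perm (Fin n)) (ξ : Fin (n + 1) → ℂ) :
    betheTerm p q x y (Equiv.Perm.decomposeFin.symm (0, e)) ξ =
      ξ 0 ^ (x 0 - y 0 - 1) * betheTerm p q (Fin.tail x) (Fin.tail y) e (Fin.tail ξ) := by
  unfold betheTerm inversionProd
  simp [Fin.prod_univ_succ, Fin.tail]
  ring

theorem betheSum_succ_of_gap {n : ℕ} {p q : ℂ} {r : ℝ} (hr : 0 < r)
    (hpq : ∀ a b : ℂ, ‖a‖ ≤ r → ‖b‖ ≤ r → p + q * a * b - b ≠ 0) {x y : Fin (n + 1) → ℤ}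
    (hx : StrictMono x) (hgap : ∀ l ≠ 0, ∑ i, (y i - x i) < y l - y 0) :
    betheSum p q r x y = (if x 0 = y 0 then 2 * Real.pi * Complex.I else 0) *
      betheSum p q r (Fin.tail x) (Fin.tail y) := by
  have hzero : ∀ σ : Equiv.Perm (Fin (n + 1)), σ 0 ≠ 0 →
      torusIntegral (betheTerm p q x y σ) 0 (fun _ => r) = 0 := by
    intro σ hσ
    by_contra hne
    have hle : ∀ i, x i ≤ y (σ i) := fun i => not_lt.1 fun h =>
      hne (torusIntegral_betheTerm_eq_zero hr hpq x y σ h)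
    have hsum : ∑ i, (y (σ i) - x i) = ∑ i, (y i - x i) := by
      rw [Finset.sum_sub_distrib, Finset.sum_sub_distrib, Equiv.sum_comp σ y]
    have h0 := Finset.single_le_sum (f := fun i => y (σ i) - x i)
      (fun i _ => sub_nonneg.2 (hle i)) (Finset.mem_univ 0)
    have h1 := hle (σ.symm 0)
    have h2 : x 0 < x (σ.symm 0) := hx <| Fin.pos_iff_ne_zero.2 fun h => hσ <| by
      rw [← h, Equiv.apply_symm_apply, h]
    have h3 := hgap _ hσ
    rw [Equiv.apply_symm_apply] at h1
    omega
  unfold betheSum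
  rw [← Equiv.sum_comp Equiv.Perm.decomposeFin.symm, Fintype.sum_prod_type, Fin.sum_univ_succ,
    Finset.sum_eq_zero (s := (Finset.univ : Finset (Fin n))), add_zero, Finset.mul_sum]
  · refine Finset.sum_congr rfl fun e _ => ?_
    have hk : x 0 = y 0 ↔ x 0 - y 0 - 1 = -1 := by omega
    simp only [hk]
    rw [← torusIntegral_zpow_mul_tail hr]
    · congr 1
      funext ξ
      exact betheTerm_decomposeFin_symm_zero p q x y e ξ
    · intro ξ hξ
      refine continuousAt_betheTerm _ _ e (fun a b => hpq _ _ (hξ a).le (hξ b).le) fun i => ?_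
      rw [← norm_ne_zero_iff, hξ]
      exact hr.ne'
  · refine fun l _ => Finset.sum_eq_zero fun e _ => hzero _ ?_
    rw [Equiv.Perm.decomposeFin_symm_apply_zero]
    exact Fin.succ_ne_zero l

theorem strictMono_sub_single_succ {n : ℕ} {x : Fin (n + 1) → ℤ} (hx : StrictMono x) (k : Fin n) :
    StrictMono (x - Pi.single k.succ 1) ↔ x k.succ ≠ x k.castSucc + 1 := by
  rw [Fin.strictMono_iff_lt_succ] at hx ⊢
  refine ⟨fun h => ?_, fun h l => ?_⟩
  · have := h k
    simp only [Pi.sub_apply, Pi.single_eq_same,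
      Pi.single_eq_of_ne (Fin.castSucc_lt_succ (i := k)).ne] at this
    omega
  · have := hx l
    simp only [Pi.sub_apply, Pi.single_apply, Fin.succ_inj]
    split_ifs with h1 h2 h2
    · omega
    · omega
    · subst h2
      omega
    · omega

theorem strictMono_add_single_castSucc {n : ℕ} {x : Fin (n + 1) → ℤ} (hx : StrictMono x)
    (k : Fin n) : StrictMono (x + Pi.single k.castSucc 1) ↔ x k.succ ≠ x k.castSucc + 1 := by
  rw [Fin.strictMono_iff_lt_succ] at hx ⊢
  refine ⟨fun h => ?_, fun h l => ?_⟩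
  · have := h k
    simp only [Pi.add_apply, Pi.single_eq_same,
      Pi.single_eq_of_ne (Fin.castSucc_lt_succ (i := k)).ne'] at this
    omega
  · have := hx l
    simp only [Pi.add_apply, Pi.single_apply, Fin.castSucc_inj]
    split_ifs with h1 h2 h2
    · omega
    · subst h1
      omega
    · omega
    · omega

theorem strictMono_sub_single_zero {n : ℕ} {x : Fin (n + 1) → ℤ} (hx : StrictMono x) :
    StrictMono (x - Pi.single 0 1) := by
  rw [Fin.strictMono_iff_lt_succ] at hx ⊢
  intro l
  have := hx l
  simp only [Pi.sub_apply, Pi.single_apply, Fin.succ_ne_zero, if_false]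
  split_ifs <;> omega

theorem strictMono_add_single_last {n : ℕ} {x : Fin (n + 1) → ℤ} (hx : StrictMono x) :
    StrictMono (x + Pi.single (Fin.last n) 1) := by
  rw [Fin.strictMono_iff_lt_succ] at hx ⊢
  intro l
  have := hx l
  simp only [Pi.add_apply, Pi.single_apply, (Fin.castSucc_lt_last l).ne, if_false]
  split_ifs <;> omega

theorem sum_neighbours_eq_sum_strictMono_neighbours {n : ℕ} {a b : ℂ}
    {f : (Fin (n + 1) → ℤ) → ℂ}
    (hf : ∀ (k : Fin n) (u : Fin (n + 1) → ℤ), u k.castSucc = u k.succ →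
      a * f u + b * f (u + Pi.single k.castSucc 1 + Pi.single k.succ 1) =
        f (u + Pi.single k.succ 1))
    {x : Fin (n + 1) → ℤ} (hx : StrictMono x) :
    a * ∑ i, f (x - Pi.single i 1) + b * ∑ i, f (x + Pi.single i 1) =
      a * (∑ i, if StrictMono (x - Pi.single i 1) then f (x - Pi.single i 1) else 0) +
      b * (∑ i, if StrictMono (x + Pi.single i 1) then f (x + Pi.single i 1) else 0) +
      (∑ k : Fin n, if x k.succ = x k.castSucc + 1 then 1 else 0) * f x := by
  have hpair : ∀ k : Fin n, x k.succ = x k.castSucc + 1 →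
      a * f (x - Pi.single k.succ 1) + b * f (x + Pi.single k.castSucc 1) = f x := by
    intro k hk
    have h := hf k (x - Pi.single k.succ 1) (by
      simp [hk, (Fin.castSucc_lt_succ (i := k)).ne])
    rwa [sub_add_cancel, add_right_comm, sub_add_cancel] at h
  have hsub : ∑ i, f (x - Pi.single i 1) =
      (∑ i, if StrictMono (x - Pi.single i 1) then f (x - Pi.single i 1) else 0) +
      ∑ k : Fin n, if x k.succ = x k.castSucc + 1 then f (x - Pi.single k.succ 1) else 0 := by
    rw [Fin.sum_univ_succ, Fin.sum_univ_succ (n := n) (fun i => ite _ _ _),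
      if_pos (strictMono_sub_single_zero hx), add_assoc, ← Finset.sum_add_distrib]
    congr 1
    refine Finset.sum_congr rfl fun k _ => ?_
    rw [if_congr (strictMono_sub_single_succ hx k) rfl rfl]
    split_ifs <;> simp_all
  have hadd : ∑ i, f (x + Pi.single i 1) =
      (∑ i, if StrictMono (x + Pi.single i 1) then f (x + Pi.single i 1) else 0) +
      ∑ k : Fin n, if x k.succ = x k.castSucc + 1 then f (x + Pi.single k.castSucc 1) else 0 := by
    rw [Fin.sum_univ_castSucc, Fin.sum_univ_castSucc (n := n) (fun i => ite _ _ _),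
      if_pos (strictMono_add_single_last hx), add_right_comm, ← Finset.sum_add_distrib]
    congr 1
    refine Finset.sum_congr rfl fun k _ => ?_
    rw [if_congr (strictMono_add_single_castSucc hx k) rfl rfl]
    split_ifs <;> simp_all
  have hadj : a * (∑ k : Fin n,
        if x k.succ = x k.castSucc + 1 then f (x - Pi.single k.succ 1) else 0) +
      b * (∑ k : Fin n,
        if x k.succ = x k.castSucc + 1 then f (x + Pi.single k.castSucc 1) else 0) =
      (∑ k : Fin n, if x k.succ = x k.castSucc + 1 then 1 else 0) * f x := by
    rw [Finset.mul_sum, Finset.mul_sum, Finset.sum_mul, ← Finset.sum_add_distrib]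
    refine Finset.sum_congr rfl fun k _ => ?_
    split_ifs with h
    · rw [hpair k h, one_mul]
    · ring
  rw [hsub, hadd, ← hadj]
  ring

theorem betheSum_sum_strictMono_neighbours {n : ℕ} {p q : ℂ} {r : ℝ} (hr : 0 < r)
    (hpq : ∀ a b : ℂ, ‖a‖ ≤ r → ‖b‖ ≤ r → p + q * a * b - b ≠ 0) {x y : Fin (n + 1) → ℤ}
    (hx : StrictMono x) (hy : StrictMono y) :
    p * (∑ i, if StrictMono (x - Pi.single i 1) then betheSum p q r (x - Pi.single i 1) y else 0) +
      q * (∑ i, if StrictMono (x + Pi.single i 1) then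
        betheSum p q r (x + Pi.single i 1) y else 0) +
      (∑ k : Fin n, if x k.succ = x k.castSucc + 1 then 1 else 0) * betheSum p q r x y =
    p * (∑ i, if StrictMono (y + Pi.single i 1) then betheSum p q r x (y + Pi.single i 1) else 0) +
      q * (∑ i, if StrictMono (y - Pi.single i 1) then
        betheSum p q r x (y - Pi.single i 1) else 0) +
      (∑ k : Fin n, if y k.succ = y k.castSucc + 1 then 1 else 0) * betheSum p q r x y := by
  rw [← sum_neighbours_eq_sum_strictMono_neighbours (f := fun u => betheSum p q r u y)
      (fun k u hu => betheSum_boundary_left hr hpq k hu y) hx, sum_betheSum_sub_single]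
  have hsub := sum_betheSum_sub_single p q r x y (-1)
  simp only [Pi.single_neg, sub_neg_eq_add, ← sub_eq_add_neg] at hsub
  have hright := sum_neighbours_eq_sum_strictMono_neighbours (f := fun u => betheSum p q r x u)
    (fun k u hu => betheSum_boundary_right hr hpq k hu x) hy
  rw [hsub]
  linear_combination hright

theorem sum_ite_strictMono_add {N : ℕ} {x y : Fin N → ℤ} (hx : StrictMono x) (hy : StrictMono y)
    (K : ℂ) (e : Fin N → Fin N → ℤ) :
    (∑ i, if StrictMono (x + e i) then (if x + e i = y then K else 0) else 0) =
      ∑ i, if StrictMono (y - e i) then (if x = y - e i then K else 0) else 0 := by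
  refine Finset.sum_congr rfl fun i _ => ?_
  by_cases h : x + e i = y
  · have h' : y - e i = x := by rw [← h, add_sub_cancel_right]
    rw [h, h', if_pos hx, if_pos hy]
    simp
  · have h' : x ≠ y - e i := fun h' => h (by rw [h', sub_add_cancel])
    simp [h, h']

theorem betheSum_add_single_zero {n : ℕ} {p q : ℂ} {r : ℝ} (hr : 0 < r)
    (hpq : ∀ a b : ℂ, ‖a‖ ≤ r → ‖b‖ ≤ r → p + q * a * b - b ≠ 0) {K : ℂ}
    {x y : Fin (n + 1) → ℤ} (hx : StrictMono x) (hy : StrictMono y)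
    (hy0 : StrictMono (y + Pi.single 0 1))
    (h : betheSum p q r x y = if x = y then K else 0)
    (hxsub : ∀ i, StrictMono (x - Pi.single i 1) →
      betheSum p q r (x - Pi.single i 1) y = if x - Pi.single i 1 = y then K else 0)
    (hxadd : ∀ i, StrictMono (x + Pi.single i 1) →
      betheSum p q r (x + Pi.single i 1) y = if x + Pi.single i 1 = y then K else 0)
    (hysub : ∀ i, StrictMono (y - Pi.single i 1) →
      betheSum p q r x (y - Pi.single i 1) = if x = y - Pi.single i 1 then K else 0)
    (hyadd : ∀ i ≠ 0, StrictMono (y + Pi.single i 1) →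
      betheSum p q r x (y + Pi.single i 1) = if x = y + Pi.single i 1 then K else 0) :
    betheSum p q r x (y + Pi.single 0 1) = if x = y + Pi.single 0 1 then K else 0 := by
  have hp : p ≠ 0 := by simpa using hpq 0 0 (by simpa using hr.le) (by simpa using hr.le)
  have hcomm := betheSum_sum_strictMono_neighbours hr hpq hx hy
  have hadd := sum_ite_strictMono_add hx hy K fun i => Pi.single i 1
  have hsub := sum_ite_strictMono_add hx hy K fun i => -Pi.single i 1
  simp only [sub_neg_eq_add, ← sub_eq_add_neg] at hsub
  have hcount : (∑ k : Fin n, if x k.succ = x k.castSucc + 1 then (1 : ℂ) else 0) *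
      (if x = y then K else 0) =
      (∑ k : Fin n, if y k.succ = y k.castSucc + 1 then 1 else 0) * (if x = y then K else 0) := by
    by_cases hxy : x = y
    · rw [hxy]
    · simp [hxy]
  have e1 : (∑ i, if StrictMono (x - Pi.single i 1) then
        betheSum p q r (x - Pi.single i 1) y else 0) =
      ∑ i, if StrictMono (x - Pi.single i 1) then (if x - Pi.single i 1 = y then K else 0) else 0 :=
    Finset.sum_congr rfl fun i _ => ite_congr rfl (hxsub i) fun _ => rfl
  have e2 : (∑ i, if StrictMono (x + Pi.single i 1) then
        betheSum p q r (x + Pi.single i 1) y else 0) =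
      ∑ i, if StrictMono (x + Pi.single i 1) then (if x + Pi.single i 1 = y then K else 0) else 0 :=
    Finset.sum_congr rfl fun i _ => ite_congr rfl (hxadd i) fun _ => rfl
  have e3 : (∑ i, if StrictMono (y - Pi.single i 1) then
        betheSum p q r x (y - Pi.single i 1) else 0) =
      ∑ i, if StrictMono (y - Pi.single i 1) then (if x = y - Pi.single i 1 then K else 0) else 0 :=
    Finset.sum_congr rfl fun i _ => ite_congr rfl (hysub i) fun _ => rfl
  have e4 : (∑ i, if StrictMono (y + Pi.single i 1) then
        betheSum p q r x (y + Pi.single i 1) else 0) =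
      betheSum p q r x (y + Pi.single 0 1) + ∑ i : Fin n, if StrictMono (y + Pi.single i.succ 1)
        then (if x = y + Pi.single i.succ 1 then K else 0) else 0 := by
    rw [Fin.sum_univ_succ, if_pos hy0]
    exact congrArg _ (Finset.sum_congr rfl fun i _ =>
      ite_congr rfl (hyadd i.succ (Fin.succ_ne_zero i)) fun _ => rfl)
  rw [e1, e2, e3, e4, h, hcount, hadd, hsub, Fin.sum_univ_succ, if_pos hy0] at hcomm
  refine mul_left_cancel₀ hp ?_
  linear_combination -hcomm

theorem sum_sub_add_single {N : ℕ} (x y : Fin N → ℤ) (i : Fin N) (ε : ℤ) :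
    ∑ l, ((y + Pi.single i ε : Fin N → ℤ) l - x l) = ∑ l, (y l - x l) + ε := by
  simp [Finset.sum_sub_distrib, Finset.sum_add_distrib, add_sub_right_comm]

theorem betheSum_eq {p q : ℂ} {r : ℝ} (hr : 0 < r)
    (hpq : ∀ a b : ℂ, ‖a‖ ≤ r → ‖b‖ ≤ r → p + q * a * b - b ≠ 0) (N : ℕ) :
    ∀ {x y : Fin N → ℤ}, StrictMono x → StrictMono y →
      betheSum p q r x y = if x = y then (2 * Real.pi * Complex.I) ^ N else 0 := by
  induction N with
  | zero =>
    intro x y _ _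
    rw [if_pos (Subsingleton.elim _ _)]
    simp [betheSum, betheTerm, inversionProd]
  | succ n ihN =>
    have base : ∀ {x y : Fin (n + 1) → ℤ}, StrictMono x → StrictMono y →
        (∀ l ≠ 0, ∑ i, (y i - x i) < y l - y 0) →
        betheSum p q r x y = if x = y then (2 * Real.pi * Complex.I) ^ (n + 1) else 0 := by
      intro x y hx hy hgap
      rw [betheSum_succ_of_gap hr hpq hx hgap,
        ihN (x := Fin.tail x) (y := Fin.tail y) (hx.comp Fin.strictMono_succ)
          (hy.comp Fin.strictMono_succ),
        ite_zero_mul_ite_zero, ← pow_succ']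
      refine if_congr ?_ rfl rfl
      simp [funext_iff, Fin.forall_fin_succ, Fin.tail]
    obtain _ | n := n
    · intro x y hx hy
      exact base hx hy fun l hl => absurd (Fin.fin_one_eq_zero l) hl
    have hle : ∀ {y : Fin (n + 2) → ℤ}, StrictMono y → ∀ l ≠ 0, y 1 ≤ y l := fun hy l hl =>
      hy.monotone (Fin.one_le_of_ne_zero hl)
    suffices key : ∀ (d : ℕ) {x y : Fin (n + 2) → ℤ}, StrictMono x → StrictMono y →
        ∑ i, (y i - x i) ≤ d →
        betheSum p q r x y = if x = y then (2 * Real.pi * Complex.I) ^ (n + 2) else 0 by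
      intro x y hx hy
      exact key _ hx hy (Int.self_le_toNat _)
    intro d
    induction d with
    | zero =>
      intro x y hx hy hd
      refine base hx hy fun l hl => ?_
      have := hy (Fin.pos_iff_ne_zero.2 hl)
      exact lt_of_le_of_lt hd (by push_cast; omega)
    | succ d ihd =>
      suffices key : ∀ (g : ℕ) {x y : Fin (n + 2) → ℤ}, StrictMono x → StrictMono y →
          ∑ i, (y i - x i) ≤ (d + 1 : ℕ) → (d + 1 : ℕ) < y 1 - y 0 + g →
          betheSum p q r x y = if x = y then (2 * Real.pi * Complex.I) ^ (n + 2) else 0 by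
        intro x y hx hy hd
        refine key (d + 1) hx hy hd ?_
        have := hy (Fin.zero_lt_one (n := n))
        omega
      intro g
      induction g with
      | zero =>
        intro x y hx hy hd hg
        refine base hx hy fun l hl => ?_
        have := hle hy l hl
        exact lt_of_le_of_lt hd (by omega)
      | succ g ihg =>
        intro x y hx hy hd hg
        obtain ⟨w, rfl⟩ : ∃ w, y = w + Pi.single 0 1 := ⟨y - Pi.single 0 1, by simp⟩
        have hw : StrictMono w := by simpa using strictMono_sub_single_zero hy
        rw [sum_sub_add_single] at hd
        simp only [Pi.add_apply, Pi.single_eq_same, Pi.single_eq_of_ne one_ne_zero] at hg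
        have hx_shift : ∀ i (ε : ℤ), ∑ l, (w l - (x + Pi.single i ε : Fin (n + 2) → ℤ) l) =
            ∑ l, (w l - x l) - ε := fun i ε => by
          simp only [Pi.add_apply, ← sub_sub, Finset.sum_sub_distrib, Finset.sum_pi_single',
            Finset.mem_univ, if_true]
        refine betheSum_add_single_zero hr hpq hx hw hy ?_ (fun i hi => ?_) (fun i hi => ?_)
          (fun i hi => ?_) (fun i hi0 hi => ?_)
        · exact ihd hx hw (by push_cast at hd; omega)
        · refine ihg hi hw ?_ (by push_cast at hg ⊢; omega)
          have := hx_shift i (-1)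
          rw [Pi.single_neg, ← sub_eq_add_neg] at this
          push_cast at hd ⊢
          omega
        · refine ihd hi hw ?_
          have := hx_shift i 1
          push_cast at hd
          omega
        · refine ihd hx hi ?_
          have := sum_sub_add_single x w i (-1)
          rw [Pi.single_neg, ← sub_eq_add_neg] at this
          push_cast at hd
          omega
        · refine ihg hx hi ?_ ?_
          · rw [sum_sub_add_single]
            exact hd
          · have h1 : 0 ≤ (Pi.single i 1 : Fin (n + 2) → ℤ) 1 := by
              rw [Pi.single_apply]
              split_ifs <;> norm_num
            simp only [Pi.add_apply, Pi.single_eq_of_ne hi0.symm]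
            push_cast at hg ⊢
            omega

/-- Initial condition for the Bethe-ansatz sum: at `t = 0`, for a strictly increasing
configuration `x_1 < ⋯ < x_N`, the sum
`Σ_σ (2πi)^{-N} ∮⋯∮ A_σ Π_i ξ_{σ(i)}^{x_i - y_{σ(i)} - 1} dξ` equals `δ_Y(X)`,
i.e. `1` if `x = y` and `0` otherwise. -/
theorem betheU_initial_condition (N : ℕ) (hN : 1 ≤ N) (p q : ℝ)
    (hp0 : 0 < p) (hp1 : p < 1) (hq : q = 1 - p)
    (y : Fin N → ℤ) (hy : StrictMono y)
    (r : ℝ) (hr : 0 < r) (hrpq : r + q * r ^ 2 < p)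
    (x : Fin N → ℤ) (hx : StrictMono x) :
    (∑ σ : Equiv.Perm (Fin N),
      (2 * (Real.pi : ℂ) * Complex.I)⁻¹ ^ N *
        multiCircleIntegral N
          (fun ξ => Aperm (p : ℂ) (q : ℂ) ξ σ *
            ∏ i, ξ (σ i) ^ (x i - y (σ i) - 1)) r) =
      if x = y then 1 else 0 := by
  have hq0 : 0 ≤ q := by rw [hq]; linarith
  have hpq : ∀ a b : ℂ, ‖a‖ ≤ r → ‖b‖ ≤ r → (p : ℂ) + q * a * b - b ≠ 0 := by
    intro a b ha hb h
    have hnorm : ‖(p : ℂ)‖ ≤ ‖b‖ + ‖(q : ℂ) * a * b‖ := by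
      rw [show (p : ℂ) = b - q * a * b by linear_combination h]
      exact norm_sub_le _ _
    rw [norm_mul, norm_mul, Complex.norm_real, Complex.norm_real, Real.norm_of_nonneg hp0.le,
      Real.norm_of_nonneg hq0] at hnorm
    have hab : q * ‖a‖ * ‖b‖ ≤ q * r * r := by gcongr
    nlinarith
  have hterm : ∀ σ : Equiv.Perm (Fin N), (fun ξ : Fin N → ℂ => Aperm (p : ℂ) (q : ℂ) ξ σ *
      ∏ i, ξ (σ i) ^ (x i - y (σ i) - 1)) = betheTerm p q x y σ := by
    intro σ
    funext ξ
    unfold betheTerm Aperm inversionProd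
    rw [Finset.prod_filter, Fintype.prod_prod_type]
  have hsum : ∀ σ : Equiv.Perm (Fin N), multiCircleIntegral N (betheTerm p q x y σ) r =
      torusIntegral (betheTerm p q x y σ) 0 (fun _ => r) := fun σ =>
    multiCircleIntegral_eq_torusIntegral hr.le fun ξ hξ => continuousAt_betheTerm x y σ
      (fun a b => hpq _ _ (hξ a).le (hξ b).le) fun i => by
        rw [← norm_ne_zero_iff, hξ]
        exact hr.ne'
  simp only [hterm, hsum]
  rw [← Finset.mul_sum, ← betheSum, betheSum_eq hr hpq N hx hy, mul_ite, mul_zero, ← mul_pow,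
    inv_mul_cancel₀ Complex.two_pi_I_ne_zero, one_pow]

end
end

section
/- (Identity #1) Let N ≥ 1 and let p, q be complex numbers with p + q = 1. Let ξ_1,…,ξ_N be complex numbers such that ξ_j ≠ 1 for all j and such that for every permutation σ ∈ S_N and every 1 ≤ k ≤ N the partial product ξ_{σ(1)} ξ_{σ(2)} ⋯ ξ_{σ(k)} ≠ 1. Then Σ_{σ∈S_N} sgn(σ) · [ Π_{i<j} f(σ(i),σ(j)) ] / [ (ξ_{σ(1)} − 1)(ξ_{σ(1)}ξ_{σ(2)} − 1) ⋯ (ξ_{σ(1)}ξ_{σ(2)}⋯ξ_{σ(N)} − 1) ] = q^{N(N−1)/2} · Π_{i<j} (ξ_j − ξ_i) / Π_{j=1}^N (ξ_j − 1). -/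
open Finset

/-- A permutation of `Fin (n + 1)` is given by the image of `Fin.last n` and a permutation of
`Fin n`. -/
def permFinLastEquiv (n : ℕ) :
    Fin (n + 1) × Equiv.Perm (Fin n) ≃ Equiv.Perm (Fin (n + 1)) :=
  (finSuccEquivLast.prodCongr (Equiv.refl _)).trans
    (Equiv.Perm.decomposeOption.symm.trans finSuccEquivLast.symm.permCongr)

lemma permFinLastEquiv_last (n : ℕ) (k : Fin (n + 1)) (τ : Equiv.Perm (Fin n)) :
    permFinLastEquiv n (k, τ) (Fin.last n) = k := by
  simp [permFinLastEquiv]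

lemma permFinLastEquiv_castSucc (n : ℕ) (k : Fin (n + 1)) (τ : Equiv.Perm (Fin n)) (i : Fin n) :
    permFinLastEquiv n (k, τ) i.castSucc = Equiv.swap (Fin.last n) k (τ i).castSucc := by
  simp only [permFinLastEquiv, Equiv.trans_apply, Equiv.prodCongr_apply, Prod.map,
    Equiv.permCongr_apply, Equiv.symm_symm, finSuccEquivLast_castSucc,
    Equiv.Perm.decomposeOption_symm_apply, Equiv.Perm.mul_apply, Equiv.refl_apply,
    Equiv.optionCongr_apply, Option.map_some]
  rw [finSuccEquivLast.symm.injective.map_swap]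
  simp

lemma prod_swap_last_castSucc {M : Type*} [CommMonoid M] {n : ℕ} (k : Fin (n + 1))
    (g : Fin (n + 1) → M) :
    ∏ i : Fin n, g (Equiv.swap (Fin.last n) k i.castSucc) = ∏ i ∈ univ.erase k, g i := by
  have h1 : ∏ i ∈ univ.erase k, g i = ∏ i, Function.update g k 1 i := by
    rw [← mul_prod_erase univ _ (mem_univ k), Function.update_self, one_mul]
    exact prod_congr rfl fun i hi => (Function.update_of_ne (ne_of_mem_erase hi) _ _).symm
  rw [h1, ← Equiv.prod_comp (Equiv.swap (Fin.last n) k), Fin.prod_univ_castSucc]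
  simp only [Equiv.swap_apply_left, Function.update_self, mul_one]
  refine prod_congr rfl fun i _ => (Function.update_of_ne ?_ _ _).symm
  intro h
  rw [← Equiv.eq_symm_apply] at h
  simp at h

section Interpolation

open Polynomial

variable {ι : Type*} [DecidableEq ι]

lemma exists_factor_prod_sub_prod (p q : ℂ) (hpq : p + q = 1) (ξ : ι → ℂ) (S : Finset ι) :
    ∃ G : ℂ[X],
      ∏ i ∈ S, (C (p - ξ i) + C (q * ξ i) * X) - ∏ i ∈ S, (C q * X - C (q * ξ i)) =
        (C q * X - C p) * G ∧
      G.degree < #S ∧ ∀ m, #S = m + 1 → G.coeff m = q ^ m * (∏ i ∈ S, ξ i - 1) := by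
  induction S using Finset.induction_on with
  | empty => exact ⟨0, by simp, by simp, by simp⟩
  | insert k S hk ih =>
    obtain ⟨G, hG, hdeg, hcoeff⟩ := ih
    have hA1 : ∀ i ∈ S, (C (p - ξ i) + C (q * ξ i) * X : ℂ[X]).natDegree ≤ 1 := fun i _ => by
      compute_degree
    have hA : (∏ i ∈ S, (C (p - ξ i) + C (q * ξ i) * X)).natDegree ≤ #S := by
      simpa using (natDegree_prod_le _ _).trans (sum_le_sum hA1)
    have hAc : (∏ i ∈ S, (C (p - ξ i) + C (q * ξ i) * X)).coeff (#S) =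
        q ^ #S * ∏ i ∈ S, ξ i := by
      simpa [prod_mul_distrib] using coeff_prod_of_natDegree_le S _ 1 hA1
    refine ⟨C (ξ k - 1) * ∏ i ∈ S, (C (p - ξ i) + C (q * ξ i) * X) +
      (C q * X - C (q * ξ k)) * G, ?_, ?_, ?_⟩
    · rw [prod_insert hk, prod_insert hk]
      have hp : p = 1 - q := by rw [← hpq]; ring
      subst hp
      simp only [map_sub, map_mul, map_one] at hG ⊢
      linear_combination (C q * X - C q * C (ξ k)) * hG
    · rw [card_insert_of_notMem hk, degree_lt_iff_coeff_zero] at *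
      intro m hm
      obtain ⟨m, rfl⟩ : ∃ l, m = l + 1 := ⟨m - 1, by omega⟩
      rw [coeff_add, coeff_C_mul, coeff_eq_zero_of_natDegree_lt (by omega : _ < m + 1),
        sub_mul (C q * X), coeff_sub, mul_assoc, coeff_C_mul, coeff_X_mul, coeff_C_mul, hdeg _ (by omega),
        hdeg _ (by omega)]
      simp
    · intro m hm
      rw [card_insert_of_notMem hk, Nat.add_right_cancel_iff] at hm
      subst hm
      have h0 : G.coeff (#S) = 0 := (degree_lt_iff_coeff_zero _ _).1 hdeg _ le_rfl
      rw [coeff_add, coeff_C_mul, hAc, sub_mul (C q * X), coeff_sub, mul_assoc, coeff_C_mul, coeff_C_mul, h0,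
        prod_insert hk]
      rcases hS : #S with _ | m
      · have : S = ∅ := card_eq_zero.1 hS
        subst this
        simp
      · rw [coeff_X_mul, hcoeff m hS]
        ring

lemma sum_prod_erase_div_sub {n : ℕ} (p q : ℂ) (hpq : p + q = 1) (ξ : ι → ℂ) (S : Finset ι)
    (hS : #S = n + 1) (hξ : Set.InjOn ξ S) :
    ∑ k ∈ S, (ξ k - 1) * ∏ i ∈ S.erase k, ((p + q * ξ i * ξ k - ξ i) / (ξ k - ξ i)) =
      q ^ n * (∏ i ∈ S, ξ i - 1) := by
  obtain ⟨G, hG, hdeg, hcoeff⟩ := exists_factor_prod_sub_prod p q hpq ξ S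
  have hw : (C q * X - C p : ℂ[X]) ≠ 0 := by
    intro h
    have h0 := congrArg (coeff · 0) h
    have h1 := congrArg (coeff · 1) h
    simp [coeff_C] at h0 h1
    simp [h0, h1] at hpq
  have hval : ∀ k ∈ S, G.eval (ξ k) =
      (ξ k - 1) * ∏ i ∈ S.erase k, (p + q * ξ i * ξ k - ξ i) := by
    intro k hk
    obtain ⟨G', hG', -⟩ := exists_factor_prod_sub_prod p q hpq ξ (S.erase k)
    have key : G = C (ξ k - 1) * ∏ i ∈ S.erase k, (C (p - ξ i) + C (q * ξ i) * X) +
        (C q * X - C (q * ξ k)) * G' := by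
      apply mul_left_cancel₀ hw
      rw [← hG, ← mul_prod_erase S _ hk, ← mul_prod_erase S _ hk]
      have hp : p = 1 - q := by rw [← hpq]; ring
      subst hp
      simp only [map_sub, map_mul, map_one] at hG' ⊢
      linear_combination (C q * X - C q * C (ξ k)) * hG'
    rw [key]
    simp only [eval_add, eval_mul, eval_sub, eval_C, eval_X, eval_prod, sub_self, zero_mul,
      add_zero]
    congr 1
    exact prod_congr rfl fun i _ => by ring
  rw [← hcoeff n hS]
  have h := Lagrange.coeff_eq_sum hξ hdeg
  rw [hS, Nat.add_sub_cancel] at h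
  rw [h]
  refine sum_congr rfl fun k hk => ?_
  rw [hval k hk, prod_div_distrib, mul_div_assoc]

end Interpolation

/-- The summand of the Tracy–Widom identity, divided by the Vandermonde product. -/
noncomputable def tracyWidomWeight (p q : ℂ) {n : ℕ} (x : Fin n → ℂ) : ℂ :=
  (∏ i, ∏ j, if i < j then (p + q * x i * x j - x i) / (x j - x i) else 1) /
    ∏ k, (∏ l ∈ univ.filter (· ≤ k), x l - 1)

lemma tracyWidomWeight_succ (p q : ℂ) {n : ℕ} (x : Fin (n + 1) → ℂ) :
    tracyWidomWeight p q x =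
      tracyWidomWeight p q (fun i => x (Fin.castSucc i)) *
        (∏ i : Fin n, (p + q * x i.castSucc * x (Fin.last n) - x i.castSucc) /
          (x (Fin.last n) - x i.castSucc)) / (∏ i, x i - 1) := by
  have h1 : ∀ k : Fin n, ∏ l ∈ univ.filter (· ≤ k.castSucc), x l =
      ∏ l ∈ univ.filter (· ≤ k), x l.castSucc := by
    intro k
    simp [prod_filter, Fin.prod_univ_castSucc, (Fin.castSucc_lt_last k).not_ge]
  have h2 : ∏ l ∈ univ.filter (· ≤ Fin.last n), x l = ∏ i, x i := by
    simp [Fin.le_last]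
  unfold tracyWidomWeight
  rw [Fin.prod_univ_castSucc (fun k => ∏ l ∈ univ.filter (· ≤ k), x l - 1), h2]
  simp only [h1, Fin.prod_univ_castSucc, Fin.castSucc_lt_castSucc_iff, Fin.castSucc_lt_last,
    if_true, (Fin.castSucc_lt_last _).not_gt, lt_irrefl, if_false, prod_const_one, mul_one,
    prod_mul_distrib]
  rw [div_mul_eq_mul_div, div_div]

theorem sum_tracyWidomWeight (p q : ℂ) (hpq : p + q = 1) (n : ℕ) (ξ : Fin n → ℂ)
    (hξ : Function.Injective ξ) (hne : ∀ s : Finset (Fin n), s.Nonempty → ∏ i ∈ s, ξ i ≠ 1) :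
    ∑ σ : Equiv.Perm (Fin n), tracyWidomWeight p q (fun i => ξ (σ i)) =
      q ^ n.choose 2 / ∏ j, (ξ j - 1) := by
  induction n with
  | zero => simp [tracyWidomWeight]
  | succ n ih =>
    have h1 : ∀ j, ξ j - 1 ≠ 0 := fun j => sub_ne_zero.2 (by simpa using hne {j} (by simp))
    have hall : ∏ i, ξ i - 1 ≠ 0 := sub_ne_zero.2 (hne univ univ_nonempty)
    rw [← Equiv.sum_comp (permFinLastEquiv n), Fintype.sum_prod_type]
    have hk : ∀ k : Fin (n + 1),
        ∑ τ : Equiv.Perm (Fin n), tracyWidomWeight p q (fun i => ξ (permFinLastEquiv n (k, τ) i)) =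
        q ^ n.choose 2 / ((∏ j, (ξ j - 1)) * (∏ i, ξ i - 1)) * ((ξ k - 1) *
          ∏ i ∈ univ.erase k, ((p + q * ξ i * ξ k - ξ i) / (ξ k - ξ i))) := by
      intro k
      have hinj : Function.Injective
          fun i : Fin n => Equiv.swap (Fin.last n) k i.castSucc :=
        (Equiv.injective _).comp (Fin.castSucc_injective n)
      have ih' := ih (fun i => ξ (Equiv.swap (Fin.last n) k i.castSucc)) (hξ.comp hinj) (by
        intro s hs
        have := hne (s.map ⟨_, hinj⟩) (hs.map)
        simpa using this)
      rw [prod_swap_last_castSucc k fun i => ξ i - 1] at ih'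
      have hterm : ∀ τ : Equiv.Perm (Fin n),
          tracyWidomWeight p q (fun i => ξ (permFinLastEquiv n (k, τ) i)) =
          tracyWidomWeight p q (fun i => ξ (Equiv.swap (Fin.last n) k (τ i).castSucc)) *
            ((∏ i ∈ univ.erase k, ((p + q * ξ i * ξ k - ξ i) / (ξ k - ξ i))) /
              (∏ i, ξ i - 1)) := by
        intro τ
        rw [tracyWidomWeight_succ]
        simp only [permFinLastEquiv_last, permFinLastEquiv_castSucc]
        rw [Equiv.prod_comp τ (fun i => (p + q * ξ (Equiv.swap (Fin.last n) k i.castSucc) * ξ k -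
            ξ (Equiv.swap (Fin.last n) k i.castSucc)) /
              (ξ k - ξ (Equiv.swap (Fin.last n) k i.castSucc))),
          prod_swap_last_castSucc k fun i => (p + q * ξ i * ξ k - ξ i) / (ξ k - ξ i),
          Equiv.prod_comp (permFinLastEquiv n (k, τ)) ξ, mul_div_assoc]
      simp only [hterm]
      rw [← sum_mul, ih', ← mul_prod_erase univ (fun j => ξ j - 1) (mem_univ k)]
      have hk1 := h1 k
      have hk2 : ∏ j ∈ univ.erase k, (ξ j - 1) ≠ 0 := prod_ne_zero_iff.2 fun j _ => h1 j
      generalize ∏ i ∈ univ.erase k, ((p + q * ξ i * ξ k - ξ i) / (ξ k - ξ i)) = P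
      field_simp
    have hall' : ∏ j, (ξ j - 1) ≠ 0 := prod_ne_zero_iff.2 fun j _ => h1 j
    simp only [hk]
    have hchoose : (n + 1).choose 2 = n + n.choose 2 := by
      rw [Nat.choose_succ_succ' n 1, Nat.choose_one_right]
    rw [← mul_sum, sum_prod_erase_div_sub (n := n) p q hpq ξ univ (by simp) hξ.injOn,
      hchoose, pow_add]
    field_simp

lemma prod_lt_sub_perm {n : ℕ} (ξ : Fin n → ℂ) (σ : Equiv.Perm (Fin n)) :
    ∏ pr ∈ univ.filter (fun pr : Fin n × Fin n => pr.1 < pr.2), (ξ (σ pr.2) - ξ (σ pr.1)) =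
      ((Equiv.Perm.sign σ : ℤ) : ℂ) *
        ∏ pr ∈ univ.filter (fun pr : Fin n × Fin n => pr.1 < pr.2), (ξ pr.2 - ξ pr.1) := by
  have h : ∀ v : Fin n → ℂ,
      ∏ pr ∈ univ.filter (fun pr : Fin n × Fin n => pr.1 < pr.2), (v pr.2 - v pr.1) =
        (Matrix.vandermonde v).det := by
    intro v
    rw [Matrix.det_vandermonde, prod_filter, Fintype.prod_prod_type]
    refine prod_congr rfl fun i _ => ?_
    rw [← prod_filter, filter_lt_eq_Ioi]
  rw [h ξ, h fun i => ξ (σ i), ← Matrix.det_permute]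
  rfl

lemma prod_ne_one_of_partial {N : ℕ} {ξ : Fin N → ℂ}
    (hpartial : ∀ (σ : Equiv.Perm (Fin N)) (k : Fin N),
      (∏ l ∈ univ.filter (fun l : Fin N => l ≤ k), ξ (σ l)) ≠ 1)
    (s : Finset (Fin N)) (hs : s.Nonempty) : ∏ i ∈ s, ξ i ≠ 1 := by
  have hc : 0 < #s := hs.card_pos
  have hcN : #s ≤ N := by simpa using card_le_univ s
  let k : Fin N := ⟨#s - 1, by omega⟩
  have hcard : #(univ.filter fun l : Fin N => l ≤ k) = #s := by
    rw [filter_ge_eq_Iic, Fin.card_Iic]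
    simp only [k]
    omega
  let e : {l : Fin N // l ∈ univ.filter fun l : Fin N => l ≤ k} ≃ {l // l ∈ s} :=
    Finset.equivOfCardEq hcard
  have h := hpartial e.extendSubtype k
  have hmap : (univ.filter fun l : Fin N => l ≤ k).map e.extendSubtype.toEmbedding = s := by
    apply eq_of_subset_of_card_le
    · intro x hx
      obtain ⟨l, hl, rfl⟩ := mem_map.1 hx
      exact e.extendSubtype_mem l hl
    · rw [card_map, hcard]
  rwa [← hmap, prod_map]



/-- Identity #1 of Tracy–Widom: with `f(i,j) = p + q ξ_i ξ_j - ξ_i`,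
`Σ_σ sgn(σ) Π_{i<j} f(σ(i),σ(j)) / Π_{k} (ξ_{σ(1)}⋯ξ_{σ(k)} - 1)
  = q^{N(N-1)/2} Π_{i<j} (ξ_j - ξ_i) / Π_j (ξ_j - 1)`. -/
theorem tracy_widom_identity_one (N : ℕ) (hN : 1 ≤ N) (p q : ℂ) (hpq : p + q = 1)
    (ξ : Fin N → ℂ) (hξ1 : ∀ j, ξ j ≠ 1)
    (hpartial : ∀ (σ : Equiv.Perm (Fin N)) (k : Fin N),
      (∏ l ∈ Finset.univ.filter (fun l : Fin N => l ≤ k), ξ (σ l)) ≠ 1) :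
    ∑ σ : Equiv.Perm (Fin N),
      ((Equiv.Perm.sign σ : ℤ) : ℂ) *
        (∏ pr ∈ Finset.univ.filter (fun pr : Fin N × Fin N => pr.1 < pr.2),
          (p + q * ξ (σ pr.1) * ξ (σ pr.2) - ξ (σ pr.1))) /
        ∏ k : Fin N, ((∏ l ∈ Finset.univ.filter (fun l : Fin N => l ≤ k), ξ (σ l)) - 1) =
      q ^ (N * (N - 1) / 2) *
        (∏ pr ∈ Finset.univ.filter (fun pr : Fin N × Fin N => pr.1 < pr.2),
          (ξ pr.2 - ξ pr.1)) /
        ∏ j : Fin N, (ξ j - 1) := by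
  by_cases hinj : Function.Injective ξ
  · have hmain := sum_tracyWidomWeight p q hpq N ξ hinj (prod_ne_one_of_partial hpartial)
    rw [mul_div_right_comm, ← Nat.choose_two_right, ← hmain, sum_mul]
    refine sum_congr rfl fun σ _ => ?_
    have hV : ∏ pr ∈ univ.filter (fun pr : Fin N × Fin N => pr.1 < pr.2),
        (ξ (σ pr.2) - ξ (σ pr.1)) ≠ 0 := by
      refine prod_ne_zero_iff.2 fun pr hpr => sub_ne_zero.2 fun h => ?_
      exact (mem_filter.1 hpr).2.ne' (σ.injective (hinj h))
    rw [tracyWidomWeight, ← Fintype.prod_prod_type' (f := fun i j : Fin N => if i < j then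
      (p + q * ξ (σ i) * ξ (σ j) - ξ (σ i)) / (ξ (σ j) - ξ (σ i)) else 1), ← prod_filter,
      prod_div_distrib, prod_lt_sub_perm ξ σ]
    rw [prod_lt_sub_perm ξ σ] at hV
    have hs2 : ((Equiv.Perm.sign σ : ℤ) : ℂ) * ((Equiv.Perm.sign σ : ℤ) : ℂ) = 1 := by
      rw [← Int.cast_mul, ← Units.val_mul, Int.units_mul_self, Units.val_one, Int.cast_one]
    rw [div_mul_eq_mul_div]
    congr 1
    rw [eq_comm, div_mul_eq_mul_div, div_eq_iff hV]
    linear_combination (-(∏ pr ∈ univ.filter (fun pr : Fin N × Fin N => pr.1 < pr.2),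
      (p + q * ξ (σ pr.1) * ξ (σ pr.2) - ξ (σ pr.1))) *
      ∏ pr ∈ univ.filter (fun pr : Fin N × Fin N => pr.1 < pr.2), (ξ pr.2 - ξ pr.1)) * hs2
  · obtain ⟨a, b, hab, hne⟩ := Function.not_injective_iff.1 hinj
    have hsw : ∀ i, ξ (Equiv.swap a b i) = ξ i := fun i => by
      rw [Equiv.swap_apply_def]
      split_ifs with h1 h2
      · rw [h1, hab]
      · rw [h2, hab]
      · rfl
    have hV : ∏ pr ∈ univ.filter (fun pr : Fin N × Fin N => pr.1 < pr.2),
        (ξ pr.2 - ξ pr.1) = 0 := by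
      have h := prod_lt_sub_perm ξ (Equiv.swap a b)
      simp only [hsw, Equiv.Perm.sign_swap hne] at h
      push_cast at h
      linear_combination h / 2
    rw [hV, mul_zero, zero_div]
    rw [← self_eq_neg, ← sum_neg_distrib]
    refine Fintype.sum_equiv (Equiv.mulLeft (Equiv.swap a b)) _ _ fun σ => ?_
    simp only [Equiv.coe_mulLeft, Equiv.Perm.mul_apply, hsw, Equiv.Perm.sign_mul,
      Equiv.Perm.sign_swap hne]
    push_cast
    ring
end

section
/- (Identity #3) Let N ≥ 1, 0 ≤ m ≤ N, and let p, q be complex numbers with p + q = 1 such that [j] ≠ 0 for all 1 ≤ j ≤ N. Let ξ_1,…,ξ_N be pairwise distinct complex numbers. Then Σ_{S ⊆ {1,…,N}, |S| = m} Π_{i ∈ S, j ∈ S^c} f(i,j)/(ξ_j − ξ_i) = [N over m], where S^c denotes the complement of S in {1,…,N}. -/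
open Finset

noncomputable section

/-- The bracket number `[n] = Σ_{j=0}^{n-1} p^j q^{n-1-j}`, which equals
`(p^n - q^n)/(p - q)` when `p ≠ q` and `p + q = 1`. -/
def brk (p q : ℂ) (n : ℕ) : ℂ := ∑ j ∈ Finset.range n, p ^ j * q ^ (n - 1 - j)

/-- The bracket factorial `[n]! = [n][n-1]⋯[1]`, with `[0]! = 1`. -/
def brkFact (p q : ℂ) : ℕ → ℂ
  | 0 => 1
  | n + 1 => brk p q (n + 1) * brkFact p q n

/-- The bracket binomial coefficient `[n over m] = [n]! / ([m]! [n-m]!)`. -/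
def brkBinom (p q : ℂ) (n m : ℕ) : ℂ := brkFact p q n / (brkFact p q m * brkFact p q (n - m))

section SplitSum

variable {K : Type*} [Field K] [DecidableEq K] (p q : K)

/-- The interaction product `∏ f(i,j)/(j - i)` over `i ∈ S`, `j ∈ R`. -/
def splitWeight (S R : Finset K) : K :=
  ∏ i ∈ S, ∏ j ∈ R, (p + q * i * j - i) / (j - i)

/-- The sum of `splitWeight` over all splittings of `T` into an `m`-subset and its complement. -/
def splitSum (T : Finset K) (m : ℕ) : K :=
  ∑ S ∈ powersetCard m T, splitWeight p q S (T \ S)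

lemma splitWeight_insert_left {x : K} {S : Finset K} (R : Finset K) (hx : x ∉ S) :
    splitWeight p q (insert x S) R =
      (∏ j ∈ R, (p + q * x * j - x) / (j - x)) * splitWeight p q S R := by
  rw [splitWeight, prod_insert hx, splitWeight]

lemma splitWeight_insert_right {x : K} (S : Finset K) {R : Finset K} (hx : x ∉ R) :
    splitWeight p q S (insert x R) =
      (∏ i ∈ S, (p + q * i * x - i) / (x - i)) * splitWeight p q S R := by
  simp only [splitWeight, prod_insert hx, prod_mul_distrib]

lemma sum_powersetCard_succ_insert {x : K} {T : Finset K} (hx : x ∉ T) (m : ℕ)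
    (F : Finset K → K) :
    ∑ S ∈ powersetCard (m + 1) (insert x T), F S =
      ∑ S ∈ powersetCard (m + 1) T, F S + ∑ S ∈ powersetCard m T, F (insert x S) := by
  rw [powersetCard_succ_insert hx, sum_union, sum_image]
  · intro A hA B hB h
    have hA' : x ∉ A := fun h => hx ((mem_powersetCard.1 hA).1 h)
    have hB' : x ∉ B := fun h => hx ((mem_powersetCard.1 hB).1 h)
    rw [← erase_insert hA', h, erase_insert hB']
  · rw [disjoint_left]
    intro A hA hA'
    obtain ⟨B, -, rfl⟩ := mem_image.1 hA'
    exact hx ((mem_powersetCard.1 hA).1 (mem_insert_self _ _))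

lemma splitSum_succ_insert {x : K} {T : Finset K} (hx : x ∉ T) (m : ℕ) :
    splitSum p q (insert x T) (m + 1) =
      ∑ S ∈ powersetCard (m + 1) T,
        (∏ i ∈ S, (p + q * i * x - i) / (x - i)) * splitWeight p q S (T \ S) +
      ∑ S ∈ powersetCard m T,
        (∏ j ∈ T \ S, (p + q * x * j - x) / (j - x)) * splitWeight p q S (T \ S) := by
  rw [splitSum, sum_powersetCard_succ_insert hx]
  congr 1 <;> refine sum_congr rfl fun S hS => ?_
  all_goals have hxS : x ∉ S := fun h => hx ((mem_powersetCard.1 hS).1 h)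
  · rw [insert_sdiff_of_notMem _ hxS, splitWeight_insert_right]
    exact fun h => hx (mem_sdiff.1 h).1
  · rw [insert_sdiff_insert, sdiff_insert_of_notMem hx, splitWeight_insert_left _ _ _ hxS]

/-- The polynomial in `x` obtained from `splitSum p q (insert x T) (m + 1)` by clearing the
denominators `x - k`, `k ∈ T`. -/
def splitNumerator (T : Finset K) (m : ℕ) : Polynomial K :=
  ∑ S ∈ powersetCard (m + 1) T, Polynomial.C (splitWeight p q S (T \ S)) *
    ((∏ i ∈ S, (Polynomial.C (q * i) * Polynomial.X + Polynomial.C (p - i))) *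
      ∏ k ∈ T \ S, (Polynomial.C 1 * Polynomial.X + Polynomial.C (-k))) +
  ∑ S ∈ powersetCard m T, Polynomial.C (splitWeight p q S (T \ S)) *
    ((∏ k ∈ S, (Polynomial.C 1 * Polynomial.X + Polynomial.C (-k))) *
      ∏ j ∈ T \ S, (Polynomial.C (1 - q * j) * Polynomial.X + Polynomial.C (-p)))

lemma eval_splitNumerator (T : Finset K) (m : ℕ) (x : K) :
    (splitNumerator p q T m).eval x =
      ∑ S ∈ powersetCard (m + 1) T, splitWeight p q S (T \ S) *
        ((∏ i ∈ S, (p + q * i * x - i)) * ∏ k ∈ T \ S, (x - k)) +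
      ∑ S ∈ powersetCard m T, splitWeight p q S (T \ S) *
        ((∏ k ∈ S, (x - k)) * ∏ j ∈ T \ S, (-(p + q * x * j - x))) := by
  simp only [splitNumerator, Polynomial.eval_add, Polynomial.eval_finsetSum,
    Polynomial.eval_mul, Polynomial.eval_prod, Polynomial.eval_C, Polynomial.eval_X]
  congr 1 <;> refine sum_congr rfl fun S _ => ?_ <;> congr 2 <;>
    exact prod_congr rfl fun _ _ => by ring

lemma natDegree_prod_linear_mul_le {S T : Finset K} (hS : S ⊆ T) (w : K) (a b c d : K → K) :
    (Polynomial.C w * ((∏ i ∈ S, (Polynomial.C (a i) * Polynomial.X + Polynomial.C (b i))) *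
      ∏ i ∈ T \ S, (Polynomial.C (c i) * Polynomial.X + Polynomial.C (d i)))).natDegree ≤
      #T := by
  have aux (R : Finset K) (a b : K → K) :
      (∏ i ∈ R, (Polynomial.C (a i) * Polynomial.X + Polynomial.C (b i))).natDegree ≤ #R := by
    refine (Polynomial.natDegree_prod_le _ _).trans ?_
    exact (sum_le_card_nsmul R _ 1 fun i _ => Polynomial.natDegree_linear_le).trans (by simp)
  refine (Polynomial.natDegree_C_mul_le _ _).trans (Polynomial.natDegree_mul_le.trans ?_)
  rw [← card_sdiff_add_card_eq_card hS, add_comm (#(T \ S))]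
  exact add_le_add (aux _ _ _) (aux _ _ _)

lemma natDegree_splitNumerator_le (T : Finset K) (m : ℕ) :
    (splitNumerator p q T m).natDegree ≤ #T := by
  refine Polynomial.natDegree_add_le_of_degree_le ?_ ?_ <;>
    refine Polynomial.natDegree_sum_le_of_forall_le _ _ fun S hS => ?_ <;>
    exact natDegree_prod_linear_mul_le (mem_powersetCard.1 hS).1 _ _ _ _ _

lemma splitSum_mul_prod_sub {x : K} {T : Finset K} (hx : x ∉ T) (m : ℕ) :
    splitSum p q (insert x T) (m + 1) * ∏ k ∈ T, (x - k) =
      (splitNumerator p q T m).eval x := by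
  rw [splitSum_succ_insert p q hx, eval_splitNumerator, add_mul, sum_mul, sum_mul]
  have hne : ∀ k ∈ T, x - k ≠ 0 := fun k hk h => hx (sub_eq_zero.1 h ▸ hk)
  congr 1 <;> refine sum_congr rfl fun S hS => ?_
  all_goals
    have hST := (mem_powersetCard.1 hS).1
    rw [← prod_sdiff hST]
  · have : (∏ i ∈ S, (p + q * i * x - i) / (x - i)) * ∏ k ∈ S, (x - k) =
        ∏ i ∈ S, (p + q * i * x - i) := by
      rw [← prod_mul_distrib]
      exact prod_congr rfl fun i hi => div_mul_cancel₀ _ (hne i (hST hi))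
    rw [← this]
    ring
  · have : (∏ j ∈ T \ S, (p + q * x * j - x) / (j - x)) * ∏ k ∈ T \ S, (x - k) =
        ∏ j ∈ T \ S, (-(p + q * x * j - x)) := by
      rw [← prod_mul_distrib]
      refine prod_congr rfl fun j hj => ?_
      have := hne j (mem_sdiff.1 hj).1
      rw [← neg_sub x j, div_neg, neg_mul, div_mul_cancel₀ _ this]
    rw [← this]
    ring

lemma eval_splitNumerator_eq_zero {b : K} {T : Finset K} (hb : b ∈ T) (m : ℕ) :
    (splitNumerator p q T m).eval b = 0 := by
  obtain ⟨U, hbU, rfl⟩ : ∃ U, b ∉ U ∧ insert b U = T :=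
    ⟨T.erase b, notMem_erase b T, insert_erase hb⟩
  rw [eval_splitNumerator, sum_powersetCard_succ_insert hbU]
  have h₁ : ∑ S ∈ powersetCard (m + 1) U, splitWeight p q S (insert b U \ S) *
      ((∏ i ∈ S, (p + q * i * b - i)) * ∏ k ∈ insert b U \ S, (b - k)) = 0 := by
    refine sum_eq_zero fun S hS => ?_
    have hbS : b ∉ S := fun h => hbU ((mem_powersetCard.1 hS).1 h)
    rw [prod_eq_zero (mem_sdiff.2 ⟨mem_insert_self b U, hbS⟩) (sub_self b), mul_zero, mul_zero]
  rw [h₁, zero_add, ← sum_subset (powersetCard_mono (subset_insert b U)), ← sum_add_distrib]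
  · refine sum_eq_zero fun S hS => ?_
    have hSU := (mem_powersetCard.1 hS).1
    have hbS : b ∉ S := fun h => hbU (hSU h)
    have hbR : b ∉ U \ S := fun h => hbU (mem_sdiff.1 h).1
    rw [insert_sdiff_insert, sdiff_insert_of_notMem hbU, insert_sdiff_of_notMem _ hbS,
      splitWeight_insert_left _ _ _ hbS, splitWeight_insert_right _ _ _ hbR,
      prod_insert hbS, prod_insert hbR]
    have hS' : (∏ i ∈ S, (p + q * i * b - i) / (b - i)) * ∏ k ∈ S, (b - k) =
        ∏ i ∈ S, (p + q * i * b - i) := by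
      rw [← prod_mul_distrib]
      refine prod_congr rfl fun i hi => div_mul_cancel₀ _ fun h => hbS ?_
      rwa [sub_eq_zero.1 h]
    have hR' : (∏ j ∈ U \ S, (p + q * b * j - b) / (j - b)) * ∏ k ∈ U \ S, (b - k) =
        ∏ j ∈ U \ S, (-(p + q * b * j - b)) := by
      rw [← prod_mul_distrib]
      refine prod_congr rfl fun j hj => ?_
      have : b - j ≠ 0 := fun h => hbR (by rwa [sub_eq_zero.1 h])
      rw [← neg_sub b j, div_neg, neg_mul, div_mul_cancel₀ _ this]
    rw [← hS', ← hR']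
    ring
  · intro S hS hSU
    have hbS : b ∈ S := by
      by_contra h
      rw [mem_powersetCard] at hS hSU
      exact hSU ⟨(subset_insert_iff_of_notMem h).1 hS.1, hS.2⟩
    rw [prod_eq_zero hbS (sub_self b), zero_mul, mul_zero]

/-- `splitSum` does not depend on the value of an individual variable. -/
lemma splitSum_insert_eq_splitSum_insert {x y : K} {T : Finset K} (hx : x ∉ T) (hy : y ∉ T)
    (m : ℕ) : splitSum p q (insert x T) (m + 1) = splitSum p q (insert y T) (m + 1) := by
  set c := splitSum p q (insert y T) (m + 1) with hc
  have hQ : splitNumerator p q T m -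
      Polynomial.C c * ∏ k ∈ T, (Polynomial.X - Polynomial.C k) = 0 := by
    refine Polynomial.eq_zero_of_natDegree_lt_card_of_eval_eq_zero' _ (insert y T) ?_ ?_
    · intro b hb
      rw [Polynomial.eval_sub, Polynomial.eval_mul, Polynomial.eval_prod]
      simp only [Polynomial.eval_C, Polynomial.eval_sub, Polynomial.eval_X]
      rcases mem_insert.1 hb with rfl | hb
      · rw [← splitSum_mul_prod_sub p q hy, sub_self]
      · rw [eval_splitNumerator_eq_zero p q hb, prod_eq_zero hb (sub_self b), mul_zero, sub_self]
    · rw [card_insert_of_notMem hy, Nat.lt_succ_iff]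
      refine (Polynomial.natDegree_sub_le_of_le (natDegree_splitNumerator_le p q T m) ?_).trans
        (max_self _).le
      refine (Polynomial.natDegree_C_mul_le _ _).trans ?_
      rw [Polynomial.natDegree_finsetProd_X_sub_C_eq_card]
  have h := congrArg (Polynomial.eval x) hQ
  rw [Polynomial.eval_sub, Polynomial.eval_mul, Polynomial.eval_prod,
    ← splitSum_mul_prod_sub p q hx] at h
  simp only [Polynomial.eval_C, Polynomial.eval_sub, Polynomial.eval_X,
    Polynomial.eval_zero] at h
  refine mul_right_cancel₀ (prod_ne_zero_iff.2 fun k hk h => ?_) (sub_eq_zero.1 h)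
  exact hx (sub_eq_zero.1 h ▸ hk)

lemma splitSum_zero (T : Finset K) : splitSum p q T 0 = 1 := by
  simp [splitSum, splitWeight]

lemma splitSum_card (T : Finset K) : splitSum p q T #T = 1 := by
  simp [splitSum, splitWeight]

variable {p q}

lemma splitSum_insert_one (hpq : p + q = 1) {T : Finset K} (hT : (1 : K) ∉ T) {m k : ℕ}
    (hcard : #T = m + k) :
    splitSum p q (insert 1 T) (m + 1) =
      p ^ (m + 1) * splitSum p q T (m + 1) + q ^ k * splitSum p q T m := by
  rw [splitSum_succ_insert p q hT, splitSum, splitSum, mul_sum, mul_sum]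
  congr 1 <;> refine sum_congr rfl fun S hS => ?_
  all_goals
    obtain ⟨hST, hSc⟩ := mem_powersetCard.1 hS
    congr 1
  · rw [← hSc]
    refine prod_eq_pow_card fun i hi => ?_
    have : (1 : K) - i ≠ 0 := fun h => hT (sub_eq_zero.1 h ▸ hST hi)
    rw [div_eq_iff this]
    linear_combination i * hpq
  · have hk : #(T \ S) = k := by rw [card_sdiff_of_subset hST]; omega
    rw [← hk]
    refine prod_eq_pow_card fun j hj => ?_
    have : j - (1 : K) ≠ 0 := fun h => hT (sub_eq_zero.1 h ▸ (mem_sdiff.1 hj).1)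
    rw [div_eq_iff this]
    linear_combination hpq

lemma splitSum_recurrence (hpq : p + q = 1) {T : Finset K} {m k : ℕ}
    (hcard : #T = m + k + 1) :
    ∃ U : Finset K, #U = m + k ∧ splitSum p q T (m + 1) =
      p ^ (m + 1) * splitSum p q U (m + 1) + q ^ k * splitSum p q U m := by
  by_cases h1 : (1 : K) ∈ T
  · have hU : #(T.erase 1) = m + k := by rw [card_erase_of_mem h1]; omega
    refine ⟨T.erase 1, hU, ?_⟩
    rw [← splitSum_insert_one hpq (notMem_erase 1 T) hU, insert_erase h1]
  · obtain ⟨x, hx⟩ : T.Nonempty := card_pos.1 (by omega)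
    have hU : #(T.erase x) = m + k := by rw [card_erase_of_mem hx]; omega
    have h1U : (1 : K) ∉ T.erase x := fun h => h1 (mem_of_mem_erase h)
    refine ⟨T.erase x, hU, ?_⟩
    rw [← splitSum_insert_one hpq h1U hU,
      ← splitSum_insert_eq_splitSum_insert p q (notMem_erase x T) h1U, insert_erase hx]

end SplitSum

lemma brk_add (p q : ℂ) (a b : ℕ) : brk p q (a + b) = q ^ b * brk p q a + p ^ a * brk p q b := by
  rw [brk, sum_range_add, brk, brk, mul_sum, mul_sum]
  congr 1 <;> refine sum_congr rfl fun j hj => ?_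
  all_goals rw [mem_range] at hj
  · rw [show a + b - 1 - j = b + (a - 1 - j) by omega, pow_add]
    ring
  · rw [show a + b - 1 - (a + j) = b - 1 - j by omega, pow_add]
    ring

lemma splitSum_mul_brkFact {p q : ℂ} (hpq : p + q = 1) (n : ℕ) :
    ∀ (m k : ℕ) (T : Finset ℂ), m + k = n → #T = n →
      splitSum p q T m * (brkFact p q m * brkFact p q k) = brkFact p q n := by
  induction n with
  | zero =>
    intro m k T hmk _
    obtain ⟨rfl, rfl⟩ : m = 0 ∧ k = 0 := by omega
    simp [splitSum_zero, brkFact]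
  | succ n ih =>
    intro m k T hmk hT
    rcases m with _ | m
    · obtain rfl : k = n + 1 := by omega
      simp [splitSum_zero, brkFact]
    rcases k with _ | k
    · obtain rfl : m = n := by omega
      rw [← hT, splitSum_card]
      simp [brkFact]
    obtain ⟨U, hU, h⟩ := splitSum_recurrence hpq (T := T) (m := m) (k := k + 1) (by omega)
    have h₁ := ih (m + 1) k U (by omega) (by omega)
    have h₂ := ih m (k + 1) U (by omega) (by omega)
    have hb := brk_add p q (m + 1) (k + 1)
    rw [hmk] at hb
    rw [h, show brkFact p q (n + 1) = brk p q (n + 1) * brkFact p q n from rfl, hb]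
    simp only [brkFact] at h₁ h₂ ⊢
    linear_combination p ^ (m + 1) * brk p q (k + 1) * h₁ + q ^ (k + 1) * brk p q (m + 1) * h₂

lemma brkFact_ne_zero {p q : ℂ} {n : ℕ} (h : ∀ j : ℕ, 1 ≤ j → j ≤ n → brk p q j ≠ 0) :
    brkFact p q n ≠ 0 := by
  induction n with
  | zero => simp [brkFact]
  | succ n ih =>
    exact mul_ne_zero (h _ (by omega) le_rfl) (ih fun j h₁ h₂ => h j h₁ (by omega))

/-- Identity #3 of Tracy–Widom: with `f(i,j) = p + q ξ_i ξ_j - ξ_i`,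
`Σ_{|S| = m} Π_{i ∈ S, j ∈ Sᶜ} f(i,j)/(ξ_j - ξ_i) = [N over m]`. -/
theorem tracy_widom_identity_three (N m : ℕ) (hN : 1 ≤ N) (hm : m ≤ N)
    (p q : ℂ) (hpq : p + q = 1)
    (hbrk : ∀ j : ℕ, 1 ≤ j → j ≤ N → brk p q j ≠ 0)
    (ξ : Fin N → ℂ) (hξ : Function.Injective ξ) :
    ∑ S ∈ Finset.powersetCard m (Finset.univ : Finset (Fin N)),
      ∏ i ∈ S, ∏ j ∈ Sᶜ, (p + q * ξ i * ξ j - ξ i) / (ξ j - ξ i) =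
      brkBinom p q N m := by
  have hsum : ∑ S ∈ Finset.powersetCard m (Finset.univ : Finset (Fin N)),
      ∏ i ∈ S, ∏ j ∈ Sᶜ, (p + q * ξ i * ξ j - ξ i) / (ξ j - ξ i) =
      splitSum p q (univ.map ⟨ξ, hξ⟩) m := by
    rw [splitSum, powersetCard_map, sum_map]
    refine sum_congr rfl fun S _ => ?_
    simp only [RelEmbedding.coe_toEmbedding, mapEmbedding_apply, splitWeight]
    rw [← Finset.map_sdiff, ← compl_eq_univ_sdiff]
    simp
  have hfact : ∀ n ≤ N, brkFact p q n ≠ 0 := fun n hn =>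
    brkFact_ne_zero fun j h₁ h₂ => hbrk j h₁ (h₂.trans hn)
  rw [hsum, brkBinom, eq_div_iff (mul_ne_zero (hfact m hm) (hfact (N - m) (N.sub_le m)))]
  exact splitSum_mul_brkFact hpq N m (N - m) _ (by omega) (by simp)

end
end

section
/- (Cauchy-type determinant identity) Let k ≥ 1 and let p, q be complex numbers with p + q = 1. Let ξ_1,…,ξ_k be complex numbers such that f(i,j) := p + q ξ_i ξ_j − ξ_i ≠ 0 for all 1 ≤ i, j ≤ k (in particular ξ_i ≠ 1 and q ξ_i ≠ p, since f(i,i) = (1 − ξ_i)(p − q ξ_i)). Then det( (1/f(i,j))_{1 ≤ i,j ≤ k} ) = (−1)^k (pq)^{k(k−1)/2} · Π_{i ≠ j} (ξ_j − ξ_i)/f(i,j) · Π_{i=1}^k 1/((1 − ξ_i)(q ξ_i − p)), where the product Π_{i≠j} runs over all ordered pairs (i,j) with i ≠ j. -/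
open Finset

/-- Elimination of the first column: the determinant of a matrix with nonzero top left entry is
that entry times the determinant of its Schur complement. -/
theorem Matrix.det_eq_mul_det_schur {K : Type*} [Field K] {n : ℕ}
    (A : Matrix (Fin (n + 1)) (Fin (n + 1)) K) (h : A 0 0 ≠ 0) :
    A.det = A 0 0 * (Matrix.of fun i j : Fin n =>
      A i.succ j.succ - A i.succ 0 / A 0 0 * A 0 j.succ).det := by
  have hB : A.det = (Matrix.of (Fin.cons (A 0) fun i j =>
      A (Fin.succ i) j - A (Fin.succ i) 0 / A 0 0 * A 0 j) :
      Matrix (Fin (n + 1)) (Fin (n + 1)) K).det := by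
    refine Matrix.det_eq_of_forall_row_eq_smul_add_const
      (Fin.cons 0 fun i => A (Fin.succ i) 0 / A 0 0) 0 (Fin.cons_zero _ _) ?_
    intro i j
    refine Fin.cases ?_ (fun i => ?_) i <;> simp
  rw [hB, Matrix.det_succ_column_zero, Fin.sum_univ_succ, Finset.sum_eq_zero, add_zero]
  · simp only [Fin.val_zero, pow_zero, one_mul, Matrix.of_apply, Fin.cons_zero,
      Fin.succAbove_zero]
    rfl
  · intro i _
    simp [h]

/-- Splitting off the index `0` in a product over off-diagonal pairs. -/
theorem Fin.prod_filter_ne_succ {M : Type*} [CommMonoid M] {n : ℕ}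
    (g : Fin (n + 1) → Fin (n + 1) → M) :
    ∏ x : Fin (n + 1) × Fin (n + 1) with x.1 ≠ x.2, g x.1 x.2 =
      (∏ i : Fin n, g i.succ 0) * (∏ j : Fin n, g 0 j.succ) *
        ∏ x : Fin n × Fin n with x.1 ≠ x.2, g x.1.succ x.2.succ := by
  simp only [Finset.prod_filter, Fintype.prod_prod_type, Fin.prod_univ_succ, ne_eq,
    not_true_eq_false, if_false, one_mul, Fin.succ_ne_zero, (Fin.succ_ne_zero _).symm,
    not_false_eq_true, if_true, Fin.succ_inj, Finset.prod_mul_distrib]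
  rw [mul_assoc, mul_left_comm]

/-- The Cauchy-type determinant identity over an arbitrary field, including the empty matrix. -/
theorem det_inv_add_mul_mul_sub {K : Type*} [Field K] (p q : K) (hpq : p + q = 1) (k : ℕ)
    (ξ : Fin k → K) (hf : ∀ i j : Fin k, p + q * ξ i * ξ j - ξ i ≠ 0) :
    Matrix.det (Matrix.of fun i j : Fin k => (p + q * ξ i * ξ j - ξ i)⁻¹) =
      (-1) ^ k * (p * q) ^ (k * (k - 1) / 2) *
        (∏ pr ∈ Finset.univ.filter (fun pr : Fin k × Fin k => pr.1 ≠ pr.2),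
          (ξ pr.2 - ξ pr.1) / (p + q * ξ pr.1 * ξ pr.2 - ξ pr.1)) *
        ∏ i : Fin k, ((1 - ξ i) * (q * ξ i - p))⁻¹ := by
  induction k with
  | zero => simp
  | succ k ih =>
    have schur_eq : (Matrix.of fun i j : Fin k =>
        (p + q * ξ i.succ * ξ j.succ - ξ i.succ)⁻¹ -
          (p + q * ξ i.succ * ξ 0 - ξ i.succ)⁻¹ / (p + q * ξ 0 * ξ 0 - ξ 0)⁻¹ *
            (p + q * ξ 0 * ξ j.succ - ξ 0)⁻¹) =
        Matrix.of fun i j : Fin k =>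
          (-(p * q) * ((ξ 0 - ξ i.succ) / (p + q * ξ i.succ * ξ 0 - ξ i.succ))) *
          (Matrix.of fun i j : Fin k =>
            (-((ξ j.succ - ξ 0) / (p + q * ξ 0 * ξ j.succ - ξ 0))) *
            (Matrix.of fun i j : Fin k =>
              (p + q * ξ i.succ * ξ j.succ - ξ i.succ)⁻¹) i j) i j := by
      ext i j
      have h₁ := hf i.succ j.succ
      have h₂ := hf i.succ 0
      have h₃ := hf 0 j.succ
      have key : (p + q * ξ i.succ * ξ 0 - ξ i.succ) * (p + q * ξ 0 * ξ j.succ - ξ 0) -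
          (p + q * ξ 0 * ξ 0 - ξ 0) * (p + q * ξ i.succ * ξ j.succ - ξ i.succ) =
          p * q * (ξ 0 - ξ i.succ) * (ξ j.succ - ξ 0) := by
        ring
      simp only [Matrix.of_apply]
      generalize p + q * ξ i.succ * ξ j.succ - ξ i.succ = a at *
      generalize p + q * ξ i.succ * ξ 0 - ξ i.succ = b at *
      generalize p + q * ξ 0 * ξ j.succ - ξ 0 = c at *
      field_simp
      linear_combination key
    have diag : (p + q * ξ 0 * ξ 0 - ξ 0)⁻¹ = -((1 - ξ 0) * (q * ξ 0 - p))⁻¹ := by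
      rw [← inv_neg]
      congr 1
      linear_combination ξ 0 * hpq
    rw [Matrix.det_eq_mul_det_schur _ (by simpa using hf 0 0)]
    simp only [Matrix.of_apply]
    rw [schur_eq, Matrix.det_mul_column, Matrix.det_mul_row,
      ih (fun i => ξ i.succ) fun i j => hf i.succ j.succ, diag,
      Fin.prod_filter_ne_succ fun i j => (ξ j - ξ i) / (p + q * ξ i * ξ j - ξ i),
      Fin.prod_univ_succ fun i => ((1 - ξ i) * (q * ξ i - p))⁻¹, Nat.triangle_succ,
      Finset.prod_mul_distrib, Finset.prod_const, Finset.card_univ,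
      Fintype.card_fin, Finset.prod_neg, Finset.card_univ, Fintype.card_fin,
      neg_pow (p * q), pow_add, pow_succ]
    have sign : ((-1 : K) ^ k) * (-1) ^ k = 1 := by
      rw [← mul_pow]
      simp
    grind

/-- Cauchy-type determinant identity of Tracy–Widom: with `f(i,j) = p + q ξ_i ξ_j - ξ_i`,
`det((1/f(i,j))) = (-1)^k (pq)^{k(k-1)/2} Π_{i≠j} (ξ_j - ξ_i)/f(i,j)
  · Π_i 1/((1 - ξ_i)(q ξ_i - p))`. -/
theorem tracy_widom_cauchy_determinant (k : ℕ) (hk : 1 ≤ k) (p q : ℂ) (hpq : p + q = 1)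
    (ξ : Fin k → ℂ) (hf : ∀ i j : Fin k, p + q * ξ i * ξ j - ξ i ≠ 0) :
    Matrix.det (Matrix.of fun i j : Fin k => (p + q * ξ i * ξ j - ξ i)⁻¹) =
      (-1) ^ k * (p * q) ^ (k * (k - 1) / 2) *
        (∏ pr ∈ Finset.univ.filter (fun pr : Fin k × Fin k => pr.1 ≠ pr.2),
          (ξ pr.2 - ξ pr.1) / (p + q * ξ pr.1 * ξ pr.2 - ξ pr.1)) *
        ∏ i : Fin k, ((1 - ξ i) * (q * ξ i - p))⁻¹ := by
  exact det_inv_add_mul_mul_sub p q hpq k ξ hf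
end

section
/- (TASEP closed form of A_σ) Let N ≥ 1 and take p = 1, q = 0, so that f(i,j) = 1 − ξ_i and S_{αβ} = −(1 − ξ_α)/(1 − ξ_β). Let ξ_1,…,ξ_N be complex numbers with ξ_α ≠ 1 for all α. Then for every permutation σ ∈ S_N, A_σ = sgn(σ) · Π_{i=1}^N (1 − ξ_{σ(i)})^{σ(i) − i}, where the (possibly negative) integer exponents σ(i) − i make sense because 1 − ξ_{σ(i)} ≠ 0. -/
open Finset

noncomputable section

theorem sign_eq_prod_inversions {N : ℕ} (σ : Equiv.Perm (Fin N)) :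
    ((Equiv.Perm.sign σ : ℤ) : ℂ) =
      ∏ _pr ∈ Finset.univ.filter (fun pr : Fin N × Fin N => pr.1 < pr.2 ∧ σ pr.2 < σ pr.1),
        (-1 : ℂ) := by
  rw [Equiv.Perm.sign_eq_prod_prod_Ioi, Finset.prod_filter, Fintype.prod_prod_type]
  push_cast
  refine Finset.prod_congr rfl fun i _ => ?_
  rw [← Finset.filter_lt_eq_Ioi, Finset.prod_filter]
  refine Finset.prod_congr rfl fun j _ => ?_
  by_cases hij : i < j
  · have hne : σ i ≠ σ j := σ.injective.ne hij.ne
    rcases lt_or_gt_of_ne hne with h | h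
    · simp [hij, h, h.not_gt]
    · simp [hij, h, h.not_gt]
  · simp [hij]

theorem card_inversions_sub_card_inversions {N : ℕ} (σ : Equiv.Perm (Fin N)) (i : Fin N) :
    ((Finset.univ.filter fun j => i < j ∧ σ j < σ i).card : ℤ) -
      ((Finset.univ.filter fun j => j < i ∧ σ i < σ j).card : ℤ) = (σ i : ℕ) - (i : ℕ) := by
  have hσ : (Finset.univ.filter fun j => σ j < σ i).card = (σ i : ℕ) := by
    rw [← Fin.card_Iio (σ i), ← Finset.card_map σ.toEmbedding]
    congr 1
    ext k
    simp [Finset.mem_map_equiv]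
  have hi : (Finset.univ.filter fun j => j < i).card = (i : ℕ) := by
    rw [Finset.filter_gt_eq_Iio, Fin.card_Iio]
  have h₁ := Finset.card_filter_add_card_filter_not
    (s := Finset.univ.filter fun j => σ j < σ i) (fun j => j < i)
  have h₂ := Finset.card_filter_add_card_filter_not
    (s := Finset.univ.filter fun j => j < i) (fun j => σ j < σ i)
  rw [Finset.filter_filter, Finset.filter_filter] at h₁ h₂
  have e₁ : (Finset.univ.filter fun j => σ j < σ i ∧ ¬ j < i) =
      Finset.univ.filter fun j => i < j ∧ σ j < σ i := by
    refine Finset.filter_congr fun j _ => ⟨fun h => ⟨?_, h.1⟩, fun h => ⟨h.2, h.1.not_gt⟩⟩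
    exact lt_of_le_of_ne (not_lt.1 h.2) fun e => h.1.ne (e ▸ rfl)
  have e₂ : (Finset.univ.filter fun j => j < i ∧ ¬ σ j < σ i) =
      Finset.univ.filter fun j => j < i ∧ σ i < σ j := by
    refine Finset.filter_congr fun j _ => ⟨fun h => ⟨h.1, ?_⟩, fun h => ⟨h.1, h.2.not_gt⟩⟩
    exact lt_of_le_of_ne (not_lt.1 h.2) fun e => h.1.ne (σ.injective e.symm)
  have e₃ : (Finset.univ.filter fun j => σ j < σ i ∧ j < i) =
      Finset.univ.filter fun j => j < i ∧ σ j < σ i :=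
    Finset.filter_congr fun j _ => and_comm
  rw [e₁, e₃] at h₁
  rw [e₂] at h₂
  lia

theorem prod_inversions_div {N : ℕ} {K : Type*} [Field K] (σ : Equiv.Perm (Fin N))
    (g : Fin N → K) (hg : ∀ i, g i ≠ 0) :
    ∏ pr ∈ Finset.univ.filter (fun pr : Fin N × Fin N => pr.1 < pr.2 ∧ σ pr.2 < σ pr.1),
      g pr.1 / g pr.2 = ∏ i, g i ^ (((σ i : ℕ) : ℤ) - ((i : ℕ) : ℤ)) := by
  have h₁ : ∏ pr ∈ Finset.univ.filter (fun pr : Fin N × Fin N => pr.1 < pr.2 ∧ σ pr.2 < σ pr.1),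
      g pr.1 = ∏ i, g i ^ (Finset.univ.filter fun j => i < j ∧ σ j < σ i).card := by
    rw [Finset.prod_filter, Fintype.prod_prod_type]
    refine Finset.prod_congr rfl fun i _ => ?_
    rw [← Finset.prod_filter]
    exact Finset.prod_const (g i)
  have h₂ : ∏ pr ∈ Finset.univ.filter (fun pr : Fin N × Fin N => pr.1 < pr.2 ∧ σ pr.2 < σ pr.1),
      g pr.2 = ∏ i, g i ^ (Finset.univ.filter fun j => j < i ∧ σ i < σ j).card := by
    rw [Finset.prod_filter, Fintype.prod_prod_type_right]
    refine Finset.prod_congr rfl fun i _ => ?_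
    rw [← Finset.prod_filter]
    exact Finset.prod_const (g i)
  rw [Finset.prod_div_distrib, h₁, h₂, ← Finset.prod_div_distrib]
  refine Finset.prod_congr rfl fun i _ => ?_
  rw [← card_inversions_sub_card_inversions, zpow_sub₀ (hg i), zpow_natCast, zpow_natCast]

/-- TASEP closed form of `A_σ`: for `p = 1`, `q = 0` (so `S_{αβ} = -(1-ξ_α)/(1-ξ_β)`),
`A_σ = sgn(σ) Π_{i=1}^N (1 - ξ_{σ(i)})^{σ(i) - i}`. -/
theorem tasep_Aperm_closed_form (N : ℕ) (hN : 1 ≤ N) (ξ : Fin N → ℂ)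
    (hξ : ∀ a : Fin N, ξ a ≠ 1) (σ : Equiv.Perm (Fin N)) :
    Aperm 1 0 ξ σ =
      ((Equiv.Perm.sign σ : ℤ) : ℂ) *
        ∏ i : Fin N, (1 - ξ (σ i)) ^ (((σ i : ℕ) : ℤ) - ((i : ℕ) : ℤ)) := by
  rw [sign_eq_prod_inversions,
    ← prod_inversions_div σ (fun i => 1 - ξ (σ i)) fun i => sub_ne_zero.2 (hξ (σ i)).symm,
    ← Finset.prod_mul_distrib, Aperm]
  refine Finset.prod_congr rfl fun pr _ => ?_
  simp only [Sfac]
  ring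

end
end
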